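/- arXiv:1911.12535 — 12 statements merged into one kernel-verified Lean document; each statement's English description precedes it below -/
import Mathlib

section
/- For every integer g ≥ 1 and every real number β with sin(g·β) ≠ 0, one has ∑_{k=1}^{g} cot(kπ/g + β) = g · cot(g·β). -/
open Real

theorem IsPrimitiveRoot.sum_range_inv_pow_mul_sub_one {K : Type*} [Field K] {ζ : K} {n : ℕ}
    (hζ : IsPrimitiveRoot ζ n) {z : K} (hz : z ^ n ≠ 1) :
    ∑ k ∈ Finset.range n, (ζ ^ k * z - 1)⁻¹ = n / (z ^ n - 1) := by
  have hpow (k : ℕ) : (ζ ^ k * z) ^ n = z ^ n := by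
    rw [mul_pow, pow_right_comm, hζ.pow_eq_one, one_pow, one_mul]
  have hterm (k : ℕ) : (ζ ^ k * z - 1)⁻¹ =
      (∑ j ∈ Finset.range n, (ζ ^ j) ^ k * z ^ j) / (z ^ n - 1) := by
    have hgeom := geom_sum_mul (ζ ^ k * z) n
    have hne : ζ ^ k * z - 1 ≠ 0 := by
      intro h0
      rw [h0, mul_zero, hpow] at hgeom
      exact sub_ne_zero.mpr hz hgeom.symm
    rw [eq_div_iff (sub_ne_zero.mpr hz), inv_mul_eq_iff_eq_mul₀ hne, ← hpow k, ← hgeom, mul_comm]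
    congr 1
    exact Finset.sum_congr rfl fun j _ ↦ by rw [mul_pow, pow_right_comm]
  simp_rw [hterm, ← Finset.sum_div]
  congr 1
  rw [Finset.sum_comm]
  simp_rw [← Finset.sum_mul]
  rw [Finset.sum_eq_single 0]
  · simp
  · intro j hj hj0
    have hne : ζ ^ j ≠ 1 := hζ.pow_ne_one_of_pos_of_lt hj0 (Finset.mem_range.mp hj)
    rw [geom_sum_eq hne, pow_right_comm, hζ.pow_eq_one, one_pow, sub_self, zero_div, zero_mul]
  · intro h0
    simp_all

theorem Complex.exp_two_I_mul_ne_one {x : ℂ} (hx : Complex.sin x ≠ 0) :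
    Complex.exp (2 * Complex.I * x) ≠ 1 := by
  intro h
  apply hx
  have : Complex.exp (x * Complex.I) = Complex.exp (-x * Complex.I) := by
    rw [show x * Complex.I = 2 * Complex.I * x + -x * Complex.I by ring, Complex.exp_add, h,
      one_mul]
  rw [Complex.sin, this, sub_self, zero_mul, zero_div]

theorem Complex.cot_eq_of_exp_ne_one {x : ℂ} (hx : Complex.exp (2 * Complex.I * x) ≠ 1) :
    Complex.cot x = Complex.I * (1 + 2 * (Complex.exp (2 * Complex.I * x) - 1)⁻¹) := by
  have h1 := sub_ne_zero.mpr hx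
  have h2 := sub_ne_zero.mpr hx.symm
  rw [Complex.cot_eq_exp_ratio]
  field_simp
  rw [Complex.I_sq]
  ring

/-- Trigonometric identity: ∑_{k=1}^{g} cot(kπ/g + β) = g·cot(gβ). -/
theorem sum_cot_eq (g : ℕ) (hg : 1 ≤ g) (β : ℝ) (h : Real.sin (g * β) ≠ 0) :
    ∑ k ∈ Finset.Icc 1 g,
        Real.cos ((k : ℝ) * π / g + β) / Real.sin ((k : ℝ) * π / g + β)
      = g * (Real.cos (g * β) / Real.sin (g * β)) := by
  have hζ := Complex.isPrimitiveRoot_exp g (by omega)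
  set ζ := Complex.exp (2 * π * Complex.I / g)
  set z := Complex.exp (2 * Complex.I * β)
  have hzg : z ^ g = Complex.exp (2 * Complex.I * (g * β)) := by
    rw [← Complex.exp_nat_mul]
    ring_nf
  have hz : z ^ g ≠ 1 := by
    rw [hzg]
    exact Complex.exp_two_I_mul_ne_one (by exact_mod_cast h)
  have hexp (k : ℕ) : Complex.exp (2 * Complex.I * (k * π / g + β)) = ζ ^ k * z := by
    rw [← Complex.exp_nat_mul, ← Complex.exp_add]
    ring_nf
  have hpow (k : ℕ) : (ζ ^ k * z) ^ g = z ^ g := by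
    rw [mul_pow, pow_right_comm, hζ.pow_eq_one, one_pow, one_mul]
  have hcot (k : ℕ) : Complex.cot (k * π / g + β) =
      Complex.I * (1 + 2 * (ζ ^ k * z - 1)⁻¹) := by
    rw [← hexp]
    refine Complex.cot_eq_of_exp_ne_one fun h1 ↦ hz ?_
    rw [← hpow k, ← hexp, h1, one_pow]
  have hζz : (ζ * z) ^ g = z ^ g := by simpa using hpow 1
  have hsum := hζ.sum_range_inv_pow_mul_sub_one (hζz ▸ hz)
  rw [hζz] at hsum
  have key : ∑ k ∈ Finset.Icc 1 g, Complex.cot (k * π / g + β) = g * Complex.cot (g * β) := by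
    rw [Complex.cot_eq_of_exp_ne_one (hzg ▸ hz), ← hzg, ← Finset.Ico_add_one_right_eq_Icc,
      Finset.sum_Ico_eq_sum_range]
    simp_rw [hcot, add_comm 1, pow_succ, mul_assoc, ← Finset.mul_sum, Finset.sum_add_distrib,
      ← Finset.mul_sum]
    simp only [add_tsub_cancel_right, hsum, Finset.sum_const, Finset.card_range, nsmul_eq_mul]
    ring
  simp only [Complex.cot] at key
  exact_mod_cast key
end

section
/- For every integer g ≥ 1 and every real number β with sin(g·β) ≠ 0, one has ∑_{k=1}^{g} cot²(kπ/g + β) = g²/sin²(g·β) − g. -/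
open Real

theorem IsPrimitiveRoot.sum_pow_pow {K : Type*} [Field K] {ζ : K} {n : ℕ}
    (hζ : IsPrimitiveRoot ζ n) (m : ℕ) :
    ∑ i ∈ Finset.range n, (ζ ^ i) ^ m = if n ∣ m then (n : K) else 0 := by
  simp_rw [pow_right_comm ζ _ m]
  split_ifs with hm
  · simp [(hζ.pow_eq_one_iff_dvd m).2 hm]
  · have hne : ζ ^ m - 1 ≠ 0 := sub_ne_zero.2 fun e => hm ((hζ.pow_eq_one_iff_dvd m).1 e)
    have hgeom := geom_sum_mul (ζ ^ m) n
    rw [pow_right_comm, hζ.pow_eq_one, one_pow, sub_self] at hgeom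
    exact (mul_eq_zero.1 hgeom).resolve_right hne

theorem IsPrimitiveRoot.sum_mul_geom_sum_sq {K : Type*} [Field K] {ζ : K} {n : ℕ}
    (hζ : IsPrimitiveRoot ζ n) (w : K) :
    ∑ i ∈ Finset.range n, w * ζ ^ i * (∑ j ∈ Finset.range n, (w * ζ ^ i) ^ j) ^ 2
      = n ^ 2 * w ^ n := by
  have hexpand (i : ℕ) : w * ζ ^ i * (∑ j ∈ Finset.range n, (w * ζ ^ i) ^ j) ^ 2
      = ∑ j ∈ Finset.range n, ∑ l ∈ Finset.range n,
          w ^ (j + l + 1) * (ζ ^ i) ^ (j + l + 1) := by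
    rw [sq, Finset.sum_mul_sum, Finset.mul_sum]
    refine Finset.sum_congr rfl fun j _ => ?_
    rw [Finset.mul_sum]
    refine Finset.sum_congr rfl fun l _ => ?_
    ring
  have hinner : ∀ j ∈ Finset.range n, ∑ l ∈ Finset.range n,
      w ^ (j + l + 1) * (if n ∣ j + l + 1 then (n : K) else 0) = n * w ^ n := by
    intro j hj
    rw [Finset.mem_range] at hj
    rw [Finset.sum_eq_single_of_mem (n - 1 - j) (Finset.mem_range.2 (by omega))]
    · rw [show j + (n - 1 - j) + 1 = n by omega, if_pos dvd_rfl, mul_comm]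
    · intro l hl hne
      rw [Finset.mem_range] at hl
      rw [if_neg, mul_zero]
      rintro ⟨c, hc⟩
      have hc2 : c < 2 := by
        by_contra! hle
        nlinarith
      interval_cases c <;> omega
  simp_rw [hexpand]
  rw [Finset.sum_comm]
  have hswap (j : ℕ) : ∑ i ∈ Finset.range n, ∑ l ∈ Finset.range n,
      w ^ (j + l + 1) * (ζ ^ i) ^ (j + l + 1)
        = ∑ l ∈ Finset.range n,
            w ^ (j + l + 1) * (if n ∣ j + l + 1 then (n : K) else 0) := by
    rw [Finset.sum_comm]
    simp_rw [← Finset.mul_sum, hζ.sum_pow_pow]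
  simp_rw [hswap]
  rw [Finset.sum_congr rfl hinner, Finset.sum_const, Finset.card_range, nsmul_eq_mul]
  ring

theorem IsPrimitiveRoot.sum_div_sub_one_sq {K : Type*} [Field K] {ζ w : K} {n : ℕ}
    (hζ : IsPrimitiveRoot ζ n) (hw : w ^ n ≠ 1) :
    ∑ i ∈ Finset.range n, w * ζ ^ i / (w * ζ ^ i - 1) ^ 2
      = n ^ 2 * w ^ n / (w ^ n - 1) ^ 2 := by
  have hW : w ^ n - 1 ≠ 0 := sub_ne_zero.2 hw
  rw [eq_div_iff (pow_ne_zero 2 hW), ← hζ.sum_mul_geom_sum_sq w, Finset.sum_mul]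
  refine Finset.sum_congr rfl fun i _ => ?_
  have hpow : (w * ζ ^ i) ^ n = w ^ n := by
    rw [mul_pow, pow_right_comm, hζ.pow_eq_one, one_pow, mul_one]
  have hz : w * ζ ^ i - 1 ≠ 0 := by
    intro e
    rw [sub_eq_zero.1 e, one_pow] at hpow
    exact hw hpow.symm
  rw [← hpow, ← geom_sum_mul]
  field_simp

theorem Complex.sin_sq_eq_exp (x : ℂ) :
    Complex.sin x ^ 2
      = -(Complex.exp (2 * x * Complex.I) - 1) ^ 2 / (4 * Complex.exp (2 * x * Complex.I)) := by
  have hexp : Complex.exp (2 * x * Complex.I) = Complex.exp (x * Complex.I) ^ 2 := by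
    rw [← Complex.exp_nat_mul]
    push_cast
    ring_nf
  have hne := Complex.exp_ne_zero (x * Complex.I)
  rw [Complex.sin, neg_mul, Complex.exp_neg, hexp]
  field_simp
  rw [Complex.I_sq]
  ring

theorem Complex.one_div_sin_sq_eq_exp (x : ℂ) :
    1 / Complex.sin x ^ 2
      = -4 * (Complex.exp (2 * x * Complex.I) / (Complex.exp (2 * x * Complex.I) - 1) ^ 2) := by
  rw [Complex.sin_sq_eq_exp, one_div_div, div_neg]
  ring

theorem Complex.sum_one_div_sin_sq {g : ℕ} (hg : g ≠ 0) {β : ℂ}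
    (h : Complex.sin (g * β) ≠ 0) :
    ∑ k ∈ Finset.Icc 1 g, 1 / Complex.sin (k * π / g + β) ^ 2
      = g ^ 2 / Complex.sin (g * β) ^ 2 := by
  have hζ := Complex.isPrimitiveRoot_exp g hg
  set ζ := Complex.exp (2 * π * Complex.I / g) with hζ_def
  set w := Complex.exp (2 * β * Complex.I) * ζ with hw_def
  have hwg : w ^ g = Complex.exp (2 * (g * β) * Complex.I) := by
    rw [hw_def, mul_pow, hζ.pow_eq_one, mul_one, ← Complex.exp_nat_mul]
    ring_nf
  have hw : w ^ g ≠ 1 := by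
    intro e
    apply h
    have hsq := Complex.sin_sq_eq_exp (g * β)
    rw [← hwg, e] at hsq
    simpa using hsq
  have hterm (i : ℕ) : Complex.exp (2 * (((1 + i : ℕ) : ℂ) * π / g + β) * Complex.I)
      = w * ζ ^ i := by
    rw [hw_def, hζ_def, ← Complex.exp_nat_mul, ← Complex.exp_add, ← Complex.exp_add]
    push_cast
    ring_nf
  rw [← Finset.Ico_add_one_right_eq_Icc, Finset.sum_Ico_eq_sum_range, Nat.add_sub_cancel,
    div_eq_mul_one_div, Complex.one_div_sin_sq_eq_exp, ← hwg]
  simp_rw [Complex.one_div_sin_sq_eq_exp, hterm]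
  rw [← Finset.mul_sum, hζ.sum_div_sub_one_sq hw]
  ring

/-- Trigonometric identity: ∑_{k=1}^{g} cot²(kπ/g + β) = g²/sin²(gβ) − g. -/
theorem sum_cot_sq_eq (g : ℕ) (hg : 1 ≤ g) (β : ℝ) (h : Real.sin (g * β) ≠ 0) :
    ∑ k ∈ Finset.Icc 1 g,
        (Real.cos ((k : ℝ) * π / g + β) / Real.sin ((k : ℝ) * π / g + β)) ^ 2
      = (g : ℝ) ^ 2 / (Real.sin (g * β)) ^ 2 - g := by
  have hg' : (g : ℝ) ≠ 0 := by positivity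
  have hsum : ∑ k ∈ Finset.Icc 1 g, 1 / Real.sin ((k : ℝ) * π / g + β) ^ 2
      = (g : ℝ) ^ 2 / Real.sin (g * β) ^ 2 := by
    have hC := Complex.sum_one_div_sin_sq (g := g) (β := β) (by omega) (by exact_mod_cast h)
    exact_mod_cast hC
  have hsin (k : ℕ) : Real.sin ((k : ℝ) * π / g + β) ≠ 0 := by
    intro e
    obtain ⟨m, hm⟩ := Real.sin_eq_zero_iff.1 e
    apply h
    refine Real.sin_eq_zero_iff.2 ⟨g * m - k, ?_⟩
    push_cast
    rw [sub_mul, mul_assoc, hm]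
    field_simp
    ring
  have hterm (k : ℕ) :
      (Real.cos ((k : ℝ) * π / g + β) / Real.sin ((k : ℝ) * π / g + β)) ^ 2
        = 1 / Real.sin ((k : ℝ) * π / g + β) ^ 2 - 1 := by
    rw [div_pow, Real.cos_sq', sub_div, div_self (pow_ne_zero 2 (hsin k))]
  simp_rw [hterm]
  rw [Finset.sum_sub_distrib, hsum]
  simp
end

section
/- Let x, x̃ : I → ℝ^k be differentiable curves on an interval I, both taking values in the Weyl chamber C and both satisfying the Euclidean MCF equation x'(t) = F(x(t)) and x̃'(t) = F(x̃(t)). Then the function D(t) = ‖x(t) − x̃(t)‖² is differentiable on I with (1/2)·D'(t) = ∑_{i=1}^{g} m_i · ⟨x(t) − x̃(t), n_i⟩² / (⟨x(t), n_i⟩ · ⟨x̃(t), n_i⟩); in particular D'(t) ≥ 0 for all t ∈ I. -/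
open scoped RealInnerProductSpace

/-- The open Weyl chamber determined by the curvature normals `nvec`. -/
def chamber {k g : ℕ} (nvec : Fin g → EuclideanSpace ℝ (Fin k)) :
    Set (EuclideanSpace ℝ (Fin k)) :=
  {x | ∀ i, ⟪x, nvec i⟫ < 0}

/-- The Euclidean mean curvature flow vector field
`F(x) = −∑ i (m i / ⟨x, nvec i⟩) • nvec i`. -/
noncomputable def mcfField {k g : ℕ} (nvec : Fin g → EuclideanSpace ℝ (Fin k))
    (m : Fin g → ℝ) (x : EuclideanSpace ℝ (Fin k)) : EuclideanSpace ℝ (Fin k) :=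
  -∑ i, (m i / ⟪x, nvec i⟫) • nvec i

/-- The monotonicity identity for the Euclidean MCF field on the Weyl chamber. -/
theorem inner_sub_mcfField_sub {k g : ℕ} {nvec : Fin g → EuclideanSpace ℝ (Fin k)}
    (m : Fin g → ℝ) {x y : EuclideanSpace ℝ (Fin k)}
    (hx : x ∈ chamber nvec) (hy : y ∈ chamber nvec) :
    ⟪x - y, mcfField nvec m x - mcfField nvec m y⟫ =
      ∑ i, m i * ⟪x - y, nvec i⟫ ^ 2 / (⟪x, nvec i⟫ * ⟪y, nvec i⟫) := by
  simp only [mcfField, inner_sub_right, inner_neg_right, inner_sum, real_inner_smul_right]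
  rw [sub_neg_eq_add, neg_add_eq_sub, ← Finset.sum_sub_distrib]
  refine Finset.sum_congr rfl fun i _ => ?_
  have hxi : ⟪x, nvec i⟫ ≠ 0 := (hx i).ne
  have hyi : ⟪y, nvec i⟫ ≠ 0 := (hy i).ne
  rw [inner_sub_left]
  field_simp

/-- For two solutions of the Euclidean MCF ODE in the Weyl chamber, the squared
distance `D(t) = ‖x(t) − x̃(t)‖²` satisfies
`(1/2)·D'(t) = ∑ i m i ⟨x−x̃, nᵢ⟩²/(⟨x, nᵢ⟩⟨x̃, nᵢ⟩) ≥ 0`. -/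
theorem deriv_sq_dist (k g : ℕ)
    (nvec : Fin g → EuclideanSpace ℝ (Fin k)) (hne : ∀ i, nvec i ≠ 0)
    (m : Fin g → ℝ) (hm : ∀ i, 0 < m i)
    (I : Set ℝ) (hI : Convex ℝ I)
    (x xt : ℝ → EuclideanSpace ℝ (Fin k))
    (hx : ∀ t ∈ I, x t ∈ chamber nvec ∧ HasDerivAt x (mcfField nvec m (x t)) t)
    (hxt : ∀ t ∈ I, xt t ∈ chamber nvec ∧ HasDerivAt xt (mcfField nvec m (xt t)) t) :
    ∀ t ∈ I,
      HasDerivAt (fun s => ‖x s - xt s‖ ^ 2)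
        (2 * ∑ i, m i * ⟪x t - xt t, nvec i⟫ ^ 2 /
          (⟪x t, nvec i⟫ * ⟪xt t, nvec i⟫)) t ∧
      0 ≤ 2 * ∑ i, m i * ⟪x t - xt t, nvec i⟫ ^ 2 /
          (⟪x t, nvec i⟫ * ⟪xt t, nvec i⟫) := by
  intro t ht
  obtain ⟨hxC, hx'⟩ := hx t ht
  obtain ⟨hxtC, hxt'⟩ := hxt t ht
  constructor
  · rw [← inner_sub_mcfField_sub m hxC hxtC]
    exact (hx'.sub hxt').norm_sq
  · exact mul_nonneg zero_le_two <| Finset.sum_nonneg fun i _ =>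
      div_nonneg (mul_nonneg (hm i).le (sq_nonneg _))
        (mul_pos_of_neg_of_neg (hxC i) (hxtC i)).le
end

section
/- Let x : I → ℝ^k be a differentiable curve on an interval I containing 0, taking values in the Weyl chamber C and satisfying x'(t) = F(x(t)). Then ‖x(t)‖² = ‖x(0)‖² − 2nt for all t ∈ I. In particular, if ‖x(0)‖ = 1 then ‖x(t)‖ = √(1 − 2nt) for all t ∈ I. -/
open scoped RealInnerProductSpace

/-- The mean curvature flow field has constant radial component `-∑ i, m i` on the chamber. -/
theorem inner_mcfField {k g : ℕ} {nvec : Fin g → EuclideanSpace ℝ (Fin k)} (m : Fin g → ℝ)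
    {x : EuclideanSpace ℝ (Fin k)} (hx : x ∈ chamber nvec) :
    ⟪x, mcfField nvec m x⟫ = -∑ i, m i := by
  rw [mcfField, inner_neg_right, inner_sum]
  congr 1
  refine Finset.sum_congr rfl fun i _ => ?_
  rw [real_inner_smul_right, div_mul_cancel₀ _ (hx i).ne]

/-- Along the Euclidean MCF ODE in the Weyl chamber, with `n = ∑ i, m i`, one has
`‖x(t)‖² = ‖x(0)‖² − 2nt`; in particular if `‖x(0)‖ = 1` then
`‖x(t)‖ = √(1 − 2nt)`. -/
theorem norm_sq_along_mcf (k g : ℕ) (hg : 0 < g)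
    (nvec : Fin g → EuclideanSpace ℝ (Fin k)) (hne : ∀ i, nvec i ≠ 0)
    (m : Fin g → ℝ) (hm : ∀ i, 0 < m i)
    (I : Set ℝ) (hI : Convex ℝ I) (h0 : (0 : ℝ) ∈ I)
    (x : ℝ → EuclideanSpace ℝ (Fin k))
    (hx : ∀ t ∈ I, x t ∈ chamber nvec ∧ HasDerivAt x (mcfField nvec m (x t)) t) :
    ∀ t ∈ I,
      ‖x t‖ ^ 2 = ‖x 0‖ ^ 2 - 2 * (∑ i, m i) * t ∧
      (‖x 0‖ = 1 → ‖x t‖ = Real.sqrt (1 - 2 * (∑ i, m i) * t)) := by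
  intro t ht
  have hderiv : ∀ s ∈ I,
      HasDerivWithinAt (fun s => ‖x s‖ ^ 2 + 2 * (∑ i, m i) * s) 0 I s := fun s hs => by
    obtain ⟨hmem, hxs⟩ := hx s hs
    refine ((hxs.norm_sq.add ((hasDerivAt_id s).const_mul (2 * ∑ i, m i))).congr_deriv
      ?_).hasDerivWithinAt
    rw [inner_mcfField m hmem]
    ring
  have hconst := hI.norm_image_sub_le_of_norm_hasDerivWithin_le (C := 0) hderiv
    (fun _ _ => norm_zero.le) h0 ht
  rw [zero_mul, norm_le_zero_iff] at hconst
  have hsq : ‖x t‖ ^ 2 = ‖x 0‖ ^ 2 - 2 * (∑ i, m i) * t := by linarith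
  refine ⟨hsq, fun h1 => ?_⟩
  rw [← Real.sqrt_sq (norm_nonneg (x t)), hsq, h1, one_pow]
end

section
/- Let y₁, y₂ : (−∞, 0] → ℝ^k be differentiable curves taking values in the Weyl chamber C and both satisfying y'(t) = F(y(t)) + n·y(t). Then ‖y₁(a) − y₂(a)‖² ≤ ‖y₁(0) − y₂(0)‖² · e^{2na} for every a ≤ 0; consequently lim_{a → −∞} ‖y₁(a) − y₂(a)‖ = 0. -/
open scoped RealInnerProductSpace

theorem inner_sub_mcfField_sub_nonneg {k g : ℕ} {nvec : Fin g → EuclideanSpace ℝ (Fin k)}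
    {m : Fin g → ℝ} (hm : ∀ i, 0 ≤ m i) {x y : EuclideanSpace ℝ (Fin k)}
    (hx : x ∈ chamber nvec) (hy : y ∈ chamber nvec) :
    0 ≤ ⟪x - y, mcfField nvec m x - mcfField nvec m y⟫ := by
  have key : ⟪x - y, mcfField nvec m x - mcfField nvec m y⟫ =
      ∑ i, m i * ⟪x - y, nvec i⟫ ^ 2 / (⟪x, nvec i⟫ * ⟪y, nvec i⟫) := by
    simp only [mcfField, inner_sub_right, inner_neg_right, inner_sum, inner_smul_right]
    rw [← Finset.sum_neg_distrib, ← Finset.sum_neg_distrib, ← Finset.sum_sub_distrib]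
    refine Finset.sum_congr rfl fun i _ => ?_
    have hxi := (hx i).ne
    have hyi := (hy i).ne
    rw [inner_sub_left]
    field_simp
    ring
  rw [key]
  exact Finset.sum_nonneg fun i _ =>
    div_nonneg (mul_nonneg (hm i) (sq_nonneg _)) (mul_pos_of_neg_of_neg (hx i) (hy i)).le

/-- Backward Grönwall inequality on `(-∞, 0]`. -/
theorem le_mul_exp_of_mul_le_deriv {f f' : ℝ → ℝ} {c : ℝ}
    (hf : ∀ t ≤ 0, HasDerivAt f (f' t) t) (hc : ∀ t ≤ 0, c * f t ≤ f' t) {a : ℝ} (ha : a ≤ 0) :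
    f a ≤ f 0 * Real.exp (c * a) := by
  have hd : ∀ t ∈ Set.Iic (0 : ℝ), HasDerivAt (fun t => f t * Real.exp (-c * t))
      ((f' t - c * f t) * Real.exp (-c * t)) t := fun t ht => by
    have h := (hf t ht).mul ((hasDerivAt_id t).const_mul (-c)).exp
    refine h.congr_deriv ?_
    simp only [id]
    ring
  have hmono : MonotoneOn (fun t => f t * Real.exp (-c * t)) (Set.Iic 0) := by
    refine monotoneOn_of_deriv_nonneg (convex_Iic 0)
      (fun t ht => (hd t ht).continuousAt.continuousWithinAt)
      (fun t ht => (hd t (interior_subset ht)).differentiableAt.differentiableWithinAt)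
      fun t ht => ?_
    rw [(hd t (interior_subset ht)).deriv]
    exact mul_nonneg (sub_nonneg.2 (hc t (Set.mem_Iic.1 (interior_subset ht)))) (Real.exp_pos _).le
  have h : f a * Real.exp (-c * a) ≤ f 0 := by
    simpa using hmono (Set.mem_Iic.2 ha) Set.self_mem_Iic ha
  rwa [neg_mul, Real.exp_neg, ← div_eq_mul_inv, div_le_iff₀ (Real.exp_pos _)] at h

/-- Any two ancient solutions of the spherical MCF ODE `y' = F(y) + n·y` in the Weyl
chamber satisfy `‖y₁(a) − y₂(a)‖² ≤ ‖y₁(0) − y₂(0)‖² e^{2na}` for `a ≤ 0`, and hence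
converge to each other as `a → −∞`. -/
theorem ancient_spherical_mcf_converge (k g : ℕ) (hg : 0 < g)
    (nvec : Fin g → EuclideanSpace ℝ (Fin k)) (hne : ∀ i, nvec i ≠ 0)
    (m : Fin g → ℝ) (hm : ∀ i, 0 < m i)
    (y₁ y₂ : ℝ → EuclideanSpace ℝ (Fin k))
    (hy₁ : ∀ t ≤ (0 : ℝ), y₁ t ∈ chamber nvec ∧
      HasDerivAt y₁ (mcfField nvec m (y₁ t) + (∑ i, m i) • y₁ t) t)
    (hy₂ : ∀ t ≤ (0 : ℝ), y₂ t ∈ chamber nvec ∧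
      HasDerivAt y₂ (mcfField nvec m (y₂ t) + (∑ i, m i) • y₂ t) t) :
    (∀ a ≤ (0 : ℝ),
      ‖y₁ a - y₂ a‖ ^ 2 ≤ ‖y₁ 0 - y₂ 0‖ ^ 2 * Real.exp (2 * (∑ i, m i) * a)) ∧
    Filter.Tendsto (fun a => ‖y₁ a - y₂ a‖) Filter.atBot (nhds 0) := by
  have hbound : ∀ a ≤ (0 : ℝ),
      ‖y₁ a - y₂ a‖ ^ 2 ≤ ‖y₁ 0 - y₂ 0‖ ^ 2 * Real.exp (2 * (∑ i, m i) * a) := fun a ha => by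
    refine le_mul_exp_of_mul_le_deriv (f := fun t => ‖y₁ t - y₂ t‖ ^ 2)
      (fun t ht => ((hy₁ t ht).2.sub (hy₂ t ht).2).norm_sq) (fun t ht => ?_) ha
    have h := inner_sub_mcfField_sub_nonneg (fun i => (hm i).le) (hy₁ t ht).1 (hy₂ t ht).1
    rw [add_sub_add_comm, ← smul_sub, Pi.sub_apply, inner_add_right, inner_smul_right,
      real_inner_self_eq_norm_sq]
    linarith
  refine ⟨hbound, ?_⟩
  have hn : 0 < ∑ i, m i := Finset.sum_pos (fun i _ => hm i) ⟨⟨0, hg⟩, Finset.mem_univ _⟩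
  have hexp : Filter.Tendsto
      (fun a => ‖y₁ 0 - y₂ 0‖ ^ 2 * Real.exp (2 * (∑ i, m i) * a)) Filter.atBot (nhds 0) := by
    simpa using (Real.tendsto_exp_atBot.comp
      (Filter.tendsto_id.const_mul_atBot (mul_pos two_pos hn))).const_mul (‖y₁ 0 - y₂ 0‖ ^ 2)
  have hsq : Filter.Tendsto (fun a => ‖y₁ a - y₂ a‖ ^ 2) Filter.atBot (nhds 0) :=
    squeeze_zero' (.of_forall fun _ => sq_nonneg _)
      ((Filter.eventually_le_atBot 0).mono hbound) hexp
  simpa [Real.sqrt_sq] using hsq.sqrt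
end

section
/- For every r > 0 and every θ ∈ (0, π/g), one has the identity in ℂ: ∑_{k=1}^{g} mult(k) · e^{iθ_k} / (r · cos(θ − θ_k)) = (n/r) · e^{iθ} · (1 + i·cot(gθ) + i·δ·csc(gθ)). Consequently the Euclidean mean curvature vector H^E(r e^{iθ}) := −∑_{k=1}^{g} mult(k) · e^{iθ_k} / (r · cos(θ − θ_k)) and the spherical mean curvature vector H^S(r e^{iθ}) := H^E(r e^{iθ}) + (n/r) · e^{iθ} satisfy H^E(r e^{iθ}) = −(n/r)·e^{iθ}·(1 + i·cot gθ + i·δ·csc gθ) and H^S(r e^{iθ}) = −(n/r)·i·e^{iθ}·(cot gθ + δ·csc gθ); in particular H^S(r e^{iθ}) = 0 if and only if θ = θ_min. -/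
open Real

/-- `n = g(m₁+m₂)/2`, the dimension of the isoparametric hypersurface. -/
noncomputable def nn (g m₁ m₂ : ℕ) : ℝ := (g : ℝ) * ((m₁ : ℝ) + (m₂ : ℝ)) / 2

/-- `δ = (m₂ − m₁)/(m₁ + m₂)`. -/
noncomputable def dlt (m₁ m₂ : ℕ) : ℝ := ((m₂ : ℝ) - (m₁ : ℝ)) / ((m₁ : ℝ) + (m₂ : ℝ))

/-- `θ_k = kπ/g − π/2`. -/
noncomputable def thk (g k : ℕ) : ℝ := (k : ℝ) * π / (g : ℝ) - π / 2

/-- `mult k = m₁` for odd `k`, `m₂` for even `k`. -/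
def mult (m₁ m₂ k : ℕ) : ℕ := if Odd k then m₁ else m₂

/-- The Euclidean mean curvature vector of the parallel hypersurface through `r·e^{iθ}`. -/
noncomputable def HE (g m₁ m₂ : ℕ) (r θ : ℝ) : ℂ :=
  -∑ k ∈ Finset.Icc 1 g, (mult m₁ m₂ k : ℂ) * Complex.exp ((thk g k : ℂ) * Complex.I) /
    ((r : ℂ) * (Real.cos (θ - thk g k) : ℂ))

/-- The spherical mean curvature vector of the parallel hypersurface through `r·e^{iθ}`. -/
noncomputable def HS (g m₁ m₂ : ℕ) (r θ : ℝ) : ℂ :=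
  HE g m₁ m₂ r θ + ((nn g m₁ m₂ : ℝ) / r : ℝ) * Complex.exp ((θ : ℂ) * Complex.I)

/-- Partial fraction decomposition of `N / (1 - w ^ N)` over the `N`-th roots of unity. -/
lemma IsPrimitiveRoot.sum_inv_one_sub_pow_mul {K : Type*} [Field K] {N : ℕ} {ζ w : K}
    (hζ : IsPrimitiveRoot ζ N) (hN : 0 < N) (hw : w ^ N ≠ 1) :
    ∑ k ∈ Finset.range N, (1 - ζ ^ k * w)⁻¹ = N / (1 - w ^ N) := by
  have hw' : 1 - w ^ N ≠ 0 := sub_ne_zero.mpr hw.symm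
  have hgeom (k : ℕ) :
      (1 - ζ ^ k * w)⁻¹ = (∑ j ∈ Finset.range N, (ζ ^ j) ^ k * w ^ j) / (1 - w ^ N) := by
    have hpow : (ζ ^ k * w) ^ N = w ^ N := by
      rw [mul_pow, ← pow_mul, mul_comm k, pow_mul, hζ.pow_eq_one, one_pow, one_mul]
    have hmul := mul_neg_geom_sum (ζ ^ k * w) N
    rw [hpow] at hmul
    have hsum : ∑ j ∈ Finset.range N, (ζ ^ j) ^ k * w ^ j
        = ∑ j ∈ Finset.range N, (ζ ^ k * w) ^ j :=
      Finset.sum_congr rfl fun j _ => by rw [mul_pow, ← pow_mul, ← pow_mul, mul_comm j]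
    have hne : 1 - ζ ^ k * w ≠ 0 := fun h => hw' (by rw [← hmul, h, zero_mul])
    rw [hsum, eq_div_iff hw', ← hmul, inv_mul_cancel_left₀ hne]
  have hzero (j : ℕ) (hj : j ∈ Finset.range N) (hj0 : j ≠ 0) :
      ∑ k ∈ Finset.range N, (ζ ^ j) ^ k * w ^ j = 0 := by
    have hne : ζ ^ j - 1 ≠ 0 :=
      sub_ne_zero.mpr (hζ.pow_ne_one_of_pos_of_lt hj0 (Finset.mem_range.mp hj))
    have hmul := mul_geom_sum (ζ ^ j) N
    rw [← pow_mul, mul_comm j, pow_mul, hζ.pow_eq_one, one_pow, sub_self] at hmul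
    rw [← Finset.sum_mul, (mul_eq_zero.mp hmul).resolve_left hne, zero_mul]
  rw [Finset.sum_congr rfl fun k _ => hgeom k, ← Finset.sum_div, Finset.sum_comm,
    Finset.sum_eq_single 0 hzero (fun h => absurd (Finset.mem_range.mpr hN) h)]
  simp

lemma Complex.exp_two_mul_I_mul_ne_one {z : ℂ} (hz : Complex.sin z ≠ 0) :
    Complex.exp (2 * Complex.I * z) ≠ 1 := by
  intro h
  apply hz
  have hsq : Complex.exp (z * Complex.I) = Complex.exp (-z * Complex.I) := by
    rw [show z * Complex.I = 2 * Complex.I * z + -z * Complex.I by ring, Complex.exp_add, h,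
      one_mul]
  rw [Complex.sin, hsq, sub_self, zero_mul, zero_div]

/-- The multiplication formula for the cotangent. -/
lemma Complex.sum_cot_sub_mul_pi_div {N : ℕ} (hN : 0 < N) (z : ℂ)
    (hz : Complex.sin (N * z) ≠ 0) :
    ∑ k ∈ Finset.range N, Complex.cot (z - k * π / N) = N * Complex.cot (N * z) := by
  have hN0 : (N : ℂ) ≠ 0 := by exact_mod_cast hN.ne'
  set ζ : ℂ := (Complex.exp (2 * π * Complex.I / N))⁻¹ with hζdef
  have hζ : IsPrimitiveRoot ζ N := (Complex.isPrimitiveRoot_exp N hN.ne').inv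
  set w : ℂ := Complex.exp (2 * Complex.I * z) with hwdef
  have hwN : w ^ N = Complex.exp (2 * Complex.I * (N * z)) := by
    rw [hwdef, ← Complex.exp_nat_mul]; congr 1; ring
  have hw : w ^ N ≠ 1 := hwN ▸ Complex.exp_two_mul_I_mul_ne_one hz
  have hw' : 1 - w ^ N ≠ 0 := sub_ne_zero.mpr hw.symm
  have hterm (k : ℕ) : Complex.cot (z - k * π / N)
      = -Complex.I * (2 * (1 - ζ ^ k * w)⁻¹ - 1) := by
    have hexp : Complex.exp (2 * Complex.I * (z - k * π / N)) = ζ ^ k * w := by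
      rw [hζdef, hwdef, ← Complex.exp_neg, ← Complex.exp_nat_mul, ← Complex.exp_add]
      congr 1; ring
    have hne : 1 - ζ ^ k * w ≠ 0 := by
      refine sub_ne_zero.mpr fun h => hw ?_
      have hpow : (ζ ^ k * w) ^ N = w ^ N := by
        rw [mul_pow, ← pow_mul, mul_comm k, pow_mul, hζ.pow_eq_one, one_pow, one_mul]
      rw [← hpow, ← h, one_pow]
    rw [Complex.cot_eq_exp_ratio, hexp]
    field_simp
    linear_combination (1 + ζ ^ k * w) * Complex.I_sq
  rw [Finset.sum_congr rfl fun k _ => hterm k, ← Finset.mul_sum, Finset.sum_sub_distrib,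
    ← Finset.mul_sum, hζ.sum_inv_one_sub_pow_mul hN hw, Complex.cot_eq_exp_ratio, ← hwN]
  simp only [Finset.sum_const, Finset.card_range, nsmul_eq_mul, mul_one]
  field_simp
  linear_combination (-(1 + w ^ N)) * Complex.I_sq

/-- The multiplication formula for the real cotangent. -/
lemma Real.sum_cot_sub_mul_pi_div {N : ℕ} (hN : 0 < N) (x : ℝ) (hx : Real.sin (N * x) ≠ 0) :
    ∑ k ∈ Finset.Icc 1 N, Real.cot (x - k * π / N) = N * Real.cot (N * x) := by
  have hN0 : (N : ℝ) ≠ 0 := by exact_mod_cast hN.ne'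
  have harg : (N : ℝ) * (x - π / N) = N * x - π := by field_simp
  have hcot : Real.cot (N * x - π) = Real.cot (N * x) := by
    simp only [Real.cot_eq_cos_div_sin, Real.cos_sub_pi, Real.sin_sub_pi, neg_div_neg_eq]
  have hsin : Real.sin (N * (x - π / N)) ≠ 0 := by
    rwa [harg, Real.sin_sub_pi, neg_ne_zero]
  have hsum : ∑ k ∈ Finset.range N, Real.cot (x - π / N - k * π / N)
      = N * Real.cot (N * (x - π / N)) := by
    have h := Complex.sum_cot_sub_mul_pi_div hN ((x - π / N : ℝ) : ℂ) (by exact_mod_cast hsin)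
    exact_mod_cast h
  rw [harg, hcot] at hsum
  rw [← hsum, Finset.range_eq_Ico]
  refine (Finset.sum_Ico_add' (fun k : ℕ => Real.cot (x - k * π / N)) 0 N 1).symm.trans ?_
  refine Finset.sum_congr rfl fun k _ => ?_
  congr 1; push_cast; ring

lemma sum_mult_mul_of_even (m₁ m₂ h : ℕ) (f : ℕ → ℝ) :
    ∑ k ∈ Finset.Icc 1 (2 * h), (mult m₁ m₂ k : ℝ) * f k
      = m₁ * ∑ k ∈ Finset.Icc 1 (2 * h), f k
        + ((m₂ : ℝ) - m₁) * ∑ k ∈ Finset.Icc 1 h, f (2 * k) := by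
  induction h with
  | zero => simp
  | succ h ih =>
    have hodd : mult m₁ m₂ (2 * h + 1) = m₁ := if_pos (by simp)
    have heven : mult m₁ m₂ (2 * h + 1 + 1) = m₂ := if_neg (by grind)
    rw [show 2 * (h + 1) = 2 * h + 1 + 1 by ring]
    simp only [Finset.sum_Icc_succ_top (Nat.le_add_left 1 _), ih, hodd, heven]
    rw [show 2 * (h + 1) = 2 * h + 1 + 1 by ring]
    ring

lemma mult_self (m k : ℕ) : mult m m k = m := ite_self m

lemma sum_mult (g m₁ m₂ : ℕ) (hodd : Odd g → m₁ = m₂) :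
    ∑ k ∈ Finset.Icc 1 g, (mult m₁ m₂ k : ℝ) = nn g m₁ m₂ := by
  rcases Nat.even_or_odd' g with ⟨h, rfl | rfl⟩
  · have := sum_mult_mul_of_even m₁ m₂ h fun _ => 1
    simp only [mul_one, Finset.sum_const, Nat.card_Icc, add_tsub_cancel_right, nsmul_eq_mul]
      at this
    rw [this, nn]; push_cast; ring
  · obtain rfl := hodd (by simp)
    simp only [mult_self, Finset.sum_const, Nat.card_Icc, add_tsub_cancel_right, nsmul_eq_mul, nn]
    ring

lemma sum_mult_mul_cot (g m₁ m₂ : ℕ) (hg : 1 ≤ g) (hm₁ : 0 < m₁) (hodd : Odd g → m₁ = m₂)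
    (θ : ℝ) (hθ : Real.sin (g * θ) ≠ 0) :
    ∑ k ∈ Finset.Icc 1 g, (mult m₁ m₂ k : ℝ) * Real.cot (θ - k * π / g)
      = nn g m₁ m₂ *
        (Real.cos (g * θ) / Real.sin (g * θ) + dlt m₁ m₂ * (1 / Real.sin (g * θ))) := by
  have hm : (m₁ : ℝ) + m₂ ≠ 0 := by positivity
  have hall := Real.sum_cot_sub_mul_pi_div hg θ hθ
  rcases Nat.even_or_odd' g with ⟨h, rfl | rfl⟩
  · have hh : 0 < h := by lia
    have hh0 : (h : ℝ) ≠ 0 := by exact_mod_cast hh.ne'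
    have hsin2 : Real.sin (((2 * h : ℕ) : ℝ) * θ) = 2 * Real.sin (h * θ) * Real.cos (h * θ) := by
      rw [← Real.sin_two_mul]; congr 1; push_cast; ring
    have hcos2 : Real.cos (((2 * h : ℕ) : ℝ) * θ) = 2 * Real.cos (h * θ) ^ 2 - 1 := by
      rw [← Real.cos_two_mul]; congr 1; push_cast; ring
    have hs : Real.sin (h * θ) ≠ 0 := fun h0 => hθ (by rw [hsin2, h0]; ring)
    have hc : Real.cos (h * θ) ≠ 0 := fun h0 => hθ (by rw [hsin2, h0]; ring)
    have heven : ∑ k ∈ Finset.Icc 1 h, Real.cot (θ - ((2 * k : ℕ) : ℝ) * π / ((2 * h : ℕ) : ℝ))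
        = h * Real.cot (h * θ) := by
      rw [← Real.sum_cot_sub_mul_pi_div hh θ hs]
      refine Finset.sum_congr rfl fun k _ => ?_
      congr 2; push_cast; field_simp
    rw [sum_mult_mul_of_even m₁ m₂ h fun k => Real.cot (θ - k * π / ((2 * h : ℕ) : ℝ)), hall,
      heven, Real.cot_eq_cos_div_sin, Real.cot_eq_cos_div_sin, hsin2, hcos2, nn, dlt]
    push_cast
    field_simp
    ring
  · obtain rfl := hodd (by simp)
    simp only [mult_self, ← Finset.mul_sum]
    rw [hall, Real.cot_eq_cos_div_sin, nn, dlt]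
    ring

/-- Dividing a unit vector by the cosine of its angle to `e^{iθ}`, in terms of the cotangent. -/
lemma exp_thk_div_cos (g k : ℕ) (θ : ℝ) (hsin : Real.sin (θ - k * π / g) ≠ 0) :
    Complex.exp ((thk g k : ℂ) * Complex.I) / (Real.cos (θ - thk g k) : ℂ)
      = Complex.exp ((θ : ℂ) * Complex.I)
        * (1 + Complex.I * (Real.cot (θ - k * π / g) : ℂ)) := by
  set y : ℝ := θ - k * π / g with hy
  have hthk : thk g k = θ - (y + π / 2) := by rw [thk, hy]; ring
  have hcos : Real.cos (θ - thk g k) = -Real.sin y := by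
    rw [hthk, sub_sub_cancel, Real.cos_add_pi_div_two]
  have hexp : Complex.exp ((thk g k : ℂ) * Complex.I)
      = Complex.exp ((θ : ℂ) * Complex.I) * (-Real.sin y - Real.cos y * Complex.I) := by
    rw [hthk, show ((θ - (y + π / 2) : ℝ) : ℂ) * Complex.I
      = (θ : ℂ) * Complex.I + ((-(y + π / 2) : ℝ) : ℂ) * Complex.I by push_cast; ring,
      Complex.exp_add, Complex.exp_mul_I (((-(y + π / 2) : ℝ) : ℂ)), ← Complex.ofReal_cos,
      ← Complex.ofReal_sin, Real.cos_neg, Real.sin_neg, Real.cos_add_pi_div_two,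
      Real.sin_add_pi_div_two]
    push_cast; ring
  have hs : (Real.sin y : ℂ) ≠ 0 := by exact_mod_cast hsin
  rw [hcos, hexp, Real.cot_eq_cos_div_sin, Complex.ofReal_div, Complex.ofReal_neg]
  field_simp
  ring

lemma sin_sub_mul_pi_div_ne_zero {g : ℕ} (hg : 1 ≤ g) (k : ℕ) {θ : ℝ}
    (hθ : Real.sin (g * θ) ≠ 0) : Real.sin (θ - k * π / g) ≠ 0 := by
  have hg0 : (g : ℝ) ≠ 0 := by positivity
  intro h
  obtain ⟨j, hj⟩ := Real.sin_eq_zero_iff.mp h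
  refine hθ (Real.sin_eq_zero_iff.mpr ⟨g * j + k, ?_⟩)
  have : θ = j * π + k * π / g := by linarith
  rw [this]; push_cast; field_simp

lemma mul_mem_Ioo_zero_pi {g : ℕ} (hg : 1 ≤ g) {θ : ℝ} (hθ : θ ∈ Set.Ioo 0 (π / (g : ℝ))) :
    (g : ℝ) * θ ∈ Set.Ioo 0 π := by
  have hg0 : (0 : ℝ) < g := by positivity
  exact ⟨mul_pos hg0 hθ.1, by simpa [mul_comm] using (lt_div_iff₀ hg0).mp hθ.2⟩

/-- Lemma 4.1: the explicit formulas for the Euclidean and spherical mean curvature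
vectors of an isoparametric hypersurface, and the characterization of the minimal
angle `θ_min`. -/
theorem mean_curvature_formula (g m₁ m₂ : ℕ) (hg : 1 ≤ g)
    (hm₁ : 0 < m₁) (hm₂ : 0 < m₂) (hodd : Odd g → m₁ = m₂)
    (θmin : ℝ) (hθmin : θmin ∈ Set.Ioo 0 (π / (g : ℝ)))
    (hmin : Real.cos ((g : ℝ) * θmin) = -dlt m₁ m₂)
    (r θ : ℝ) (hr : 0 < r) (hθ : θ ∈ Set.Ioo 0 (π / (g : ℝ))) :
    (∑ k ∈ Finset.Icc 1 g, (mult m₁ m₂ k : ℂ) *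
        Complex.exp ((thk g k : ℂ) * Complex.I) /
        ((r : ℂ) * (Real.cos (θ - thk g k) : ℂ))
      = ((nn g m₁ m₂ / r : ℝ) : ℂ) * Complex.exp ((θ : ℂ) * Complex.I) *
        (1 + Complex.I * ((Real.cos ((g : ℝ) * θ) / Real.sin ((g : ℝ) * θ) : ℝ) : ℂ)
           + Complex.I * ((dlt m₁ m₂ : ℝ) : ℂ) *
             ((1 / Real.sin ((g : ℝ) * θ) : ℝ) : ℂ))) ∧
    HE g m₁ m₂ r θ
      = -(((nn g m₁ m₂ / r : ℝ) : ℂ) * Complex.exp ((θ : ℂ) * Complex.I) *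
        (1 + Complex.I * ((Real.cos ((g : ℝ) * θ) / Real.sin ((g : ℝ) * θ) : ℝ) : ℂ)
           + Complex.I * ((dlt m₁ m₂ : ℝ) : ℂ) *
             ((1 / Real.sin ((g : ℝ) * θ) : ℝ) : ℂ))) ∧
    HS g m₁ m₂ r θ
      = -(((nn g m₁ m₂ / r : ℝ) : ℂ) * Complex.I * Complex.exp ((θ : ℂ) * Complex.I) *
        (((Real.cos ((g : ℝ) * θ) / Real.sin ((g : ℝ) * θ) : ℝ) : ℂ)
           + ((dlt m₁ m₂ : ℝ) : ℂ) * ((1 / Real.sin ((g : ℝ) * θ) : ℝ) : ℂ))) ∧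
    (HS g m₁ m₂ r θ = 0 ↔ θ = θmin) := by
  have hgθ := mul_mem_Ioo_zero_pi hg hθ
  have hsin : Real.sin (g * θ) ≠ 0 := (Real.sin_pos_of_mem_Ioo hgθ).ne'
  have hr0 : (r : ℂ) ≠ 0 := by exact_mod_cast hr.ne'
  have hsum : ∑ k ∈ Finset.Icc 1 g, (mult m₁ m₂ k : ℂ) *
        Complex.exp ((thk g k : ℂ) * Complex.I) /
        ((r : ℂ) * (Real.cos (θ - thk g k) : ℂ))
      = ((nn g m₁ m₂ / r : ℝ) : ℂ) * Complex.exp ((θ : ℂ) * Complex.I) *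
        (1 + Complex.I * ((Real.cos ((g : ℝ) * θ) / Real.sin ((g : ℝ) * θ) : ℝ) : ℂ)
           + Complex.I * ((dlt m₁ m₂ : ℝ) : ℂ) *
             ((1 / Real.sin ((g : ℝ) * θ) : ℝ) : ℂ)) := by
    have hterm (k : ℕ) : (mult m₁ m₂ k : ℂ) * Complex.exp ((thk g k : ℂ) * Complex.I) /
          ((r : ℂ) * (Real.cos (θ - thk g k) : ℂ))
        = Complex.exp ((θ : ℂ) * Complex.I) / r * (((mult m₁ m₂ k : ℝ) : ℂ)
          + Complex.I * (((mult m₁ m₂ k : ℝ) * Real.cot (θ - k * π / g) : ℝ) : ℂ)) := by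
      rw [mul_div_mul_comm,
        exp_thk_div_cos g k θ (sin_sub_mul_pi_div_ne_zero hg k hsin)]
      push_cast
      ring
    rw [Finset.sum_congr rfl fun k _ => hterm k, ← Finset.mul_sum, Finset.sum_add_distrib,
      ← Finset.mul_sum, ← Complex.ofReal_sum, ← Complex.ofReal_sum, sum_mult g m₁ m₂ hodd,
      sum_mult_mul_cot g m₁ m₂ hg hm₁ hodd θ hsin]
    simp only [Complex.ofReal_mul, Complex.ofReal_add, Complex.ofReal_div]
    ring
  have hHE : HE g m₁ m₂ r θ = _ := congrArg Neg.neg hsum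
  have hHS : HS g m₁ m₂ r θ
      = -(((nn g m₁ m₂ / r : ℝ) : ℂ) * Complex.I * Complex.exp ((θ : ℂ) * Complex.I) *
        (((Real.cos ((g : ℝ) * θ) / Real.sin ((g : ℝ) * θ) : ℝ) : ℂ)
           + ((dlt m₁ m₂ : ℝ) : ℂ) * ((1 / Real.sin ((g : ℝ) * θ) : ℝ) : ℂ))) := by
    rw [HS, hHE]
    ring
  refine ⟨hsum, hHE, hHS, ?_⟩
  have hn : nn g m₁ m₂ / r ≠ 0 := by
    have : (0 : ℝ) < g := by positivity
    rw [nn]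
    positivity
  have hn' : ((nn g m₁ m₂ / r : ℝ) : ℂ) ≠ 0 := Complex.ofReal_ne_zero.mpr hn
  have hcos : Real.cos (g * θ) / Real.sin (g * θ) + dlt m₁ m₂ * (1 / Real.sin (g * θ)) = 0
      ↔ Real.cos (g * θ) = Real.cos (g * θmin) := by
    rw [hmin, mul_one_div, ← add_div, div_eq_zero_iff, or_iff_left hsin, add_eq_zero_iff_eq_neg]
  rw [hHS, neg_eq_zero, mul_eq_zero, or_iff_right
    (mul_ne_zero (mul_ne_zero hn' Complex.I_ne_zero) (Complex.exp_ne_zero _)),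
    ← Complex.ofReal_mul, ← Complex.ofReal_add, Complex.ofReal_eq_zero, hcos,
    Real.injOn_cos.eq_iff (Set.Ioo_subset_Icc_self hgθ)
      (Set.Ioo_subset_Icc_self (mul_mem_Ioo_zero_pi hg hθmin)),
    mul_right_inj' (by positivity)]
end

section
/- For every r > 0 and every θ ∈ (0, π/g), one has ∑_{k=1}^{g} mult(k) / (r·cos(θ − θ_k))² = (n·g/r²) · (1 + δ·cos(gθ)) / sin²(gθ). In particular, if cos(gθ) = −δ (i.e. θ = θ_min), then ∑_{k=1}^{g} mult(k) / (r·cos(θ − θ_k))² = n·g/r², and ∑_{k=1}^{g} mult(k) / (r·cos(θ − θ_k))² − n/r² = n(g−1)/r². -/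
open Real

/-- Discrete Parseval identity for the geometric sums of `z * ζ ^ k`. -/
theorem sum_geom_mul_geom_inv {K : Type*} [Field K] {ζ z : K} {g : ℕ}
    (hζ : IsPrimitiveRoot ζ g) (hg : g ≠ 0) (hz : z ≠ 0) :
    ∑ k ∈ Finset.range g, (∑ j ∈ Finset.range g, (z * ζ ^ k) ^ j) *
      (∑ l ∈ Finset.range g, ((z * ζ ^ k)⁻¹) ^ l) = (g : K) ^ 2 := by
  have hζ0 : ζ ≠ 0 := hζ.ne_zero hg
  have orth : ∀ j ∈ Finset.range g, ∀ l ∈ Finset.range g,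
      ∑ k ∈ Finset.range g, (z * ζ ^ k) ^ j * ((z * ζ ^ k)⁻¹) ^ l =
        if j = l then (g : K) else 0 := by
    intro j hj l hl
    rw [Finset.mem_range] at hj hl
    split_ifs with h
    · subst h
      have : ∀ k ∈ Finset.range g, (z * ζ ^ k) ^ j * ((z * ζ ^ k)⁻¹) ^ j = 1 := by
        intro k _
        rw [← mul_pow, mul_inv_cancel₀ (mul_ne_zero hz (pow_ne_zero _ hζ0)), one_pow]
      rw [Finset.sum_congr rfl this]
      simp
    · have hterm : ∀ k ∈ Finset.range g, (z * ζ ^ k) ^ j * ((z * ζ ^ k)⁻¹) ^ l =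
          z ^ j * (z⁻¹) ^ l * (ζ ^ j * (ζ ^ l)⁻¹) ^ k := by
        intro k _
        simp only [mul_pow, mul_inv, inv_pow, ← pow_mul, mul_comm k]
        ring
      have hne : ζ ^ j * (ζ ^ l)⁻¹ ≠ 1 := by
        intro h1
        rw [mul_inv_eq_one₀ (pow_ne_zero _ hζ0)] at h1
        exact h (hζ.pow_inj hj hl h1)
      have hone : (ζ ^ j * (ζ ^ l)⁻¹) ^ g = 1 := by
        rw [mul_pow, inv_pow, ← pow_mul, ← pow_mul, mul_comm j, mul_comm l, pow_mul, pow_mul,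
          hζ.pow_eq_one]
        simp
      rw [Finset.sum_congr rfl hterm, ← Finset.mul_sum, geom_sum_eq hne, hone]
      simp
  simp_rw [Finset.sum_mul_sum]
  rw [Finset.sum_comm]
  have : ∀ j ∈ Finset.range g, ∑ k ∈ Finset.range g, ∑ l ∈ Finset.range g,
      (z * ζ ^ k) ^ j * ((z * ζ ^ k)⁻¹) ^ l = (g : K) := by
    intro j hj
    rw [Finset.sum_comm, Finset.sum_congr rfl (orth j hj), Finset.sum_ite_eq, if_pos hj]
  rw [Finset.sum_congr rfl this]
  simp [sq]

theorem exp_sub_one_mul_exp_inv_sub_one (y : ℂ) :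
    (Complex.exp (2 * y * Complex.I) - 1) * ((Complex.exp (2 * y * Complex.I))⁻¹ - 1) =
      4 * Complex.sin y ^ 2 := by
  have h : Complex.exp (2 * y * Complex.I) = Complex.exp (y * Complex.I) ^ 2 := by
    rw [← Complex.exp_nat_mul]
    congr 1
    push_cast
    ring
  have h0 := Complex.exp_ne_zero (y * Complex.I)
  rw [h, Complex.sin, neg_mul, Complex.exp_neg]
  field_simp
  rw [Complex.I_sq]
  ring

/-- The Fejér kernel as a product of two geometric sums. -/
theorem geom_mul_geom_inv_mul_sin_sq (g : ℕ) (y : ℂ) :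
    (∑ j ∈ Finset.range g, Complex.exp (2 * y * Complex.I) ^ j) *
      (∑ l ∈ Finset.range g, ((Complex.exp (2 * y * Complex.I))⁻¹) ^ l) * Complex.sin y ^ 2 =
      Complex.sin (g * y) ^ 2 := by
  have h1 := exp_sub_one_mul_exp_inv_sub_one y
  have h2 := exp_sub_one_mul_exp_inv_sub_one (g * y)
  have h3 : Complex.exp (2 * (g * y) * Complex.I) = Complex.exp (2 * y * Complex.I) ^ g := by
    rw [← Complex.exp_nat_mul]
    congr 1
    ring
  rw [h3, ← inv_pow, ← geom_sum_mul, ← geom_sum_mul] at h2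
  linear_combination (1 / 4 : ℂ) * h2 - (1 / 4 : ℂ) *
    (∑ j ∈ Finset.range g, Complex.exp (2 * y * Complex.I) ^ j) *
      (∑ l ∈ Finset.range g, ((Complex.exp (2 * y * Complex.I))⁻¹) ^ l) * h1

theorem sin_nat_mul_add_sq (g k : ℕ) (hg : g ≠ 0) (x : ℝ) :
    sin (g * (x + k * π / g)) ^ 2 = sin (g * x) ^ 2 := by
  have hg' : (g : ℝ) ≠ 0 := Nat.cast_ne_zero.mpr hg
  have : (g : ℝ) * (x + k * π / g) = g * x + k * π := by field_simp
  rw [this, Real.sin_add_nat_mul_pi, mul_pow, ← pow_mul, mul_comm k, pow_mul]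
  simp

/-- `∑ 1 / sin² (x + kπ/g) = g² / sin² (gx)`. -/
theorem sum_inv_sin_sq (g : ℕ) (hg : g ≠ 0) (x : ℝ) (hx : sin (g * x) ≠ 0) :
    ∑ k ∈ Finset.range g, 1 / sin (x + k * π / g) ^ 2 = (g : ℝ) ^ 2 / sin (g * x) ^ 2 := by
  have hgC : (g : ℂ) ≠ 0 := Nat.cast_ne_zero.mpr hg
  have hP := sum_geom_mul_geom_inv (Complex.isPrimitiveRoot_exp g hg) hg
    (Complex.exp_ne_zero (2 * x * Complex.I))
  have hw : ∀ k : ℕ, Complex.exp (2 * x * Complex.I) * Complex.exp (2 * π * Complex.I / g) ^ k =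
      Complex.exp (2 * ((x + k * π / g : ℝ) : ℂ) * Complex.I) := by
    intro k
    rw [← Complex.exp_nat_mul, ← Complex.exp_add]
    congr 1
    push_cast
    ring
  have hterm : ∀ k : ℕ,
      (∑ j ∈ Finset.range g,
        (Complex.exp (2 * x * Complex.I) * Complex.exp (2 * π * Complex.I / g) ^ k) ^ j) *
      (∑ l ∈ Finset.range g,
        ((Complex.exp (2 * x * Complex.I) * Complex.exp (2 * π * Complex.I / g) ^ k)⁻¹) ^ l) =
      ((sin (g * x) ^ 2 * (1 / sin (x + k * π / g) ^ 2) : ℝ) : ℂ) := by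
    intro k
    have hF := geom_mul_geom_inv_mul_sin_sq g ((x + k * π / g : ℝ) : ℂ)
    have hs := sin_nat_mul_add_sq g k hg x
    have hne : sin (x + k * π / g) ≠ 0 := by
      intro h0
      rw [← Complex.ofReal_sin, h0] at hF
      have h1 : sin (g * (x + k * π / g)) ^ 2 = 0 := by
        have : ((sin (g * (x + k * π / g)) ^ 2 : ℝ) : ℂ) = 0 := by
          push_cast at hF ⊢
          rw [← hF]
          simp
        exact_mod_cast this
      rw [hs] at h1
      exact hx (pow_eq_zero_iff two_ne_zero |>.mp h1)
    rw [hw, mul_one_div, ← hs, Complex.ofReal_div, eq_div_iff (by exact_mod_cast pow_ne_zero 2 hne)]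
    rw [← Complex.ofReal_sin] at hF
    push_cast at hF ⊢
    exact hF
  rw [Finset.sum_congr rfl (fun k _ => hterm k), ← Complex.ofReal_sum, ← Finset.mul_sum] at hP
  rw [eq_div_iff (pow_ne_zero 2 hx), mul_comm]
  exact_mod_cast hP

theorem cos_sub_thk (g k : ℕ) (θ : ℝ) : cos (θ - thk g k) = sin (k * π / g - θ) := by
  rw [thk, ← Real.cos_pi_div_two_sub]
  congr 1
  ring

theorem sum_range_two_mul {M : Type*} [AddCommMonoid M] (f : ℕ → M) (p : ℕ) :
    ∑ i ∈ Finset.range (2 * p), f i =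
      ∑ j ∈ Finset.range p, f (2 * j) + ∑ j ∈ Finset.range p, f (2 * j + 1) := by
  induction p with
  | zero => simp
  | succ p ih =>
    rw [show 2 * (p + 1) = 2 * p + 1 + 1 by ring, Finset.sum_range_succ, Finset.sum_range_succ, ih,
      Finset.sum_range_succ, Finset.sum_range_succ]
    abel

theorem sum_mult_div_sin_sq (g m₁ m₂ : ℕ) (hg : g ≠ 0) (hm₁ : 0 < m₁)
    (hodd : Odd g → m₁ = m₂) (θ : ℝ) (hs : sin (g * θ) ≠ 0) :
    ∑ i ∈ Finset.range g, (mult m₁ m₂ (i + 1) : ℝ) / sin ((i + 1 : ℕ) * π / g - θ) ^ 2 =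
      nn g m₁ m₂ * g * (1 + dlt m₁ m₂ * cos (g * θ)) / sin (g * θ) ^ 2 := by
  have hg' : (g : ℝ) ≠ 0 := Nat.cast_ne_zero.mpr hg
  have hm : (m₁ : ℝ) + m₂ ≠ 0 := by positivity
  rcases Nat.even_or_odd' g with ⟨p, rfl | rfl⟩
  · have hp : p ≠ 0 := by omega
    have hp' : (p : ℝ) ≠ 0 := Nat.cast_ne_zero.mpr hp
    have hd : ((2 * p : ℕ) : ℝ) * θ = 2 * (p * θ) := by push_cast; ring
    rw [hd, Real.sin_two_mul] at hs
    have hsin : sin (p * θ) ≠ 0 := fun h => hs (by simp [h])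
    have hcos : cos (p * θ) ≠ 0 := fun h => hs (by simp [h])
    have e1 : sin (p * (π / (2 * p) - θ)) = cos (p * θ) := by
      rw [← Real.sin_pi_div_two_sub]
      congr 1
      field_simp
    have e2 : sin (p * (π / p - θ)) = sin (p * θ) := by
      rw [← Real.sin_pi_sub]
      congr 1
      field_simp
      ring
    have s1 := sum_inv_sin_sq p hp (π / (2 * p) - θ) (by rwa [e1])
    have s2 := sum_inv_sin_sq p hp (π / p - θ) (by rwa [e2])
    rw [e1] at s1
    rw [e2] at s2
    have t1 : ∀ j ∈ Finset.range p, (mult m₁ m₂ (2 * j + 1) : ℝ) /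
        sin ((2 * j + 1 : ℕ) * π / (2 * p : ℕ) - θ) ^ 2 =
        m₁ * (1 / sin (π / (2 * p) - θ + j * π / p) ^ 2) := by
      intro j _
      rw [mult, if_pos ⟨j, rfl⟩, mul_one_div]
      congr 3
      push_cast
      field_simp
      ring
    have t2 : ∀ j ∈ Finset.range p, (mult m₁ m₂ (2 * j + 1 + 1) : ℝ) /
        sin ((2 * j + 1 + 1 : ℕ) * π / (2 * p : ℕ) - θ) ^ 2 =
        m₂ * (1 / sin (π / p - θ + j * π / p) ^ 2) := by
      intro j _
      rw [mult, if_neg (by rw [Nat.not_odd_iff_even]; exact ⟨j + 1, by ring⟩), mul_one_div]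
      congr 3
      push_cast
      field_simp
      ring
    rw [sum_range_two_mul, Finset.sum_congr rfl t1, Finset.sum_congr rfl t2, ← Finset.mul_sum,
      ← Finset.mul_sum, s1, s2, hd, Real.sin_two_mul, Real.cos_two_mul, nn, dlt]
    have hsq := Real.sin_sq_add_cos_sq (p * θ)
    push_cast
    field_simp
    rw [show sin (p * θ) ^ 2 = 1 - cos (p * θ) ^ 2 by linarith]
    ring
  · obtain rfl := hodd ⟨p, rfl⟩
    generalize 2 * p + 1 = g at *
    have e : sin (g * (π / g - θ)) = sin (g * θ) := by
      rw [← Real.sin_pi_sub]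
      congr 1
      field_simp
      ring
    have s := sum_inv_sin_sq g hg (π / g - θ) (by rwa [e])
    have t : ∀ i ∈ Finset.range g, (mult m₁ m₁ (i + 1) : ℝ) / sin ((i + 1 : ℕ) * π / g - θ) ^ 2 =
        m₁ * (1 / sin (π / g - θ + i * π / g) ^ 2) := by
      intro i _
      rw [mult, ite_self, mul_one_div]
      congr 3
      push_cast
      field_simp
      ring
    rw [Finset.sum_congr rfl t, ← Finset.mul_sum, s, e, nn, dlt]
    field_simp
    ring

/-- Lemma 4.6 and Corollary 4.7: the squared norm of the Euclidean shape operator of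
the parallel hypersurface through `r·e^{iθ}` equals `(ng/r²)(1 + δcos gθ)/sin²(gθ)`;
at the minimal angle (`cos gθ = −δ`) it equals `ng/r²`, and subtracting `n/r²`
gives `n(g−1)/r²`. -/
theorem shape_operator_norm (g m₁ m₂ : ℕ) (hg : 1 ≤ g)
    (hm₁ : 0 < m₁) (hm₂ : 0 < m₂) (hodd : Odd g → m₁ = m₂)
    (r θ : ℝ) (hr : 0 < r) (hθ : θ ∈ Set.Ioo 0 (π / (g : ℝ))) :
    (∑ k ∈ Finset.Icc 1 g, (mult m₁ m₂ k : ℝ) / (r * Real.cos (θ - thk g k)) ^ 2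
      = nn g m₁ m₂ * g / r ^ 2 * (1 + dlt m₁ m₂ * Real.cos ((g : ℝ) * θ)) /
          (Real.sin ((g : ℝ) * θ)) ^ 2) ∧
    (Real.cos ((g : ℝ) * θ) = -dlt m₁ m₂ →
      (∑ k ∈ Finset.Icc 1 g, (mult m₁ m₂ k : ℝ) / (r * Real.cos (θ - thk g k)) ^ 2
          = nn g m₁ m₂ * g / r ^ 2) ∧
      (∑ k ∈ Finset.Icc 1 g, (mult m₁ m₂ k : ℝ) / (r * Real.cos (θ - thk g k)) ^ 2)
          - nn g m₁ m₂ / r ^ 2 = nn g m₁ m₂ * ((g : ℝ) - 1) / r ^ 2) := by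
  have hg0 : g ≠ 0 := by omega
  have hgpos : (0 : ℝ) < g := by exact_mod_cast hg
  have hs : sin (g * θ) ≠ 0 := by
    refine (Real.sin_pos_of_pos_of_lt_pi (mul_pos hgpos hθ.1) ?_).ne'
    have := (lt_div_iff₀ hgpos).mp hθ.2
    linarith
  have key : ∑ k ∈ Finset.Icc 1 g, (mult m₁ m₂ k : ℝ) / (r * Real.cos (θ - thk g k)) ^ 2
      = nn g m₁ m₂ * g / r ^ 2 * (1 + dlt m₁ m₂ * Real.cos ((g : ℝ) * θ)) /
          (Real.sin ((g : ℝ) * θ)) ^ 2 := by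
    have h := sum_mult_div_sin_sq g m₁ m₂ hg0 hm₁ hodd θ hs
    rw [Finset.range_eq_Ico,
      Finset.sum_Ico_add' (fun k : ℕ => (mult m₁ m₂ k : ℝ) / sin (k * π / g - θ) ^ 2) 0 g 1,
      zero_add, Finset.Ico_add_one_right_eq_Icc] at h
    calc ∑ k ∈ Finset.Icc 1 g, (mult m₁ m₂ k : ℝ) / (r * Real.cos (θ - thk g k)) ^ 2
        = ∑ k ∈ Finset.Icc 1 g, (1 / r ^ 2) * ((mult m₁ m₂ k : ℝ) / sin (k * π / g - θ) ^ 2) := by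
          refine Finset.sum_congr rfl fun k _ => ?_
          rw [cos_sub_thk, mul_pow, div_mul_div_comm, one_mul]
      _ = _ := by
          rw [← Finset.mul_sum, h]
          ring
  refine ⟨key, fun hc => ?_⟩
  have hmin : ∑ k ∈ Finset.Icc 1 g, (mult m₁ m₂ k : ℝ) / (r * Real.cos (θ - thk g k)) ^ 2
      = nn g m₁ m₂ * g / r ^ 2 := by
    have h1 : 1 + dlt m₁ m₂ * cos (g * θ) = sin (g * θ) ^ 2 := by
      rw [Real.sin_sq, hc]
      ring
    rw [key, h1, mul_div_cancel_right₀ _ (pow_ne_zero 2 hs)]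
  refine ⟨hmin, ?_⟩
  rw [hmin]
  ring
end

section
/- Let J ⊆ (−∞, 1/(2n)) be an interval containing 0, and let r, θ : J → ℝ be differentiable functions with r(t) > 0 and θ(t) ∈ (0, π/g) for all t ∈ J, satisfying r'(t) = −n/r(t), θ'(t) = −(n/r(t)²)·(cot(gθ(t)) + δ·csc(gθ(t))), r(0) = 1, and θ(0) = θ₀. Then for all t ∈ J: r(t) = √(1 − 2nt) and cos(gθ(t)) = (1 − 2nt)^{−g/2}·(cos(gθ₀) + δ) − δ. -/
open Real

/-- A function whose derivative vanishes on a convex set of reals is constant there. -/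
theorem Convex.eq_of_hasDerivAt_zero {s : Set ℝ} (hs : Convex ℝ s) {f : ℝ → ℝ}
    (hf : ∀ x ∈ s, HasDerivAt f 0 x) {x y : ℝ} (hx : x ∈ s) (hy : y ∈ s) : f y = f x := by
  have h := hs.norm_image_sub_le_of_norm_hasDerivWithin_le (C := 0)
    (fun z hz => (hf z hz).hasDerivWithinAt) (fun z _ => by simp) hx hy
  rw [zero_mul, norm_le_zero_iff] at h
  exact sub_eq_zero.mp h

/-- Proposition 4.2: the explicit solution of the Euclidean MCF for isoparametric
hypersurfaces in polar coordinates: `r(t) = √(1−2nt)` and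
`cos gθ(t) = (1−2nt)^{−g/2}(cos gθ₀ + δ) − δ`. -/
theorem euclidean_mcf_polar_solution (g m₁ m₂ : ℕ) (hg : 1 ≤ g)
    (hm₁ : 0 < m₁) (hm₂ : 0 < m₂) (hodd : Odd g → m₁ = m₂)
    (J : Set ℝ) (hJconv : Convex ℝ J) (hJ0 : (0 : ℝ) ∈ J)
    (hJsub : J ⊆ Set.Iio (1 / (2 * nn g m₁ m₂)))
    (r θ : ℝ → ℝ) (θ₀ : ℝ)
    (hr : ∀ t ∈ J, 0 < r t ∧ HasDerivAt r (-(nn g m₁ m₂) / r t) t)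
    (hθ : ∀ t ∈ J, θ t ∈ Set.Ioo 0 (π / (g : ℝ)) ∧
      HasDerivAt θ (-(nn g m₁ m₂ / (r t) ^ 2) *
        (Real.cos ((g : ℝ) * θ t) / Real.sin ((g : ℝ) * θ t)
          + dlt m₁ m₂ * (1 / Real.sin ((g : ℝ) * θ t)))) t)
    (hr0 : r 0 = 1) (hθ0 : θ 0 = θ₀) :
    ∀ t ∈ J,
      r t = Real.sqrt (1 - 2 * nn g m₁ m₂ * t) ∧
      Real.cos ((g : ℝ) * θ t)
        = (1 - 2 * nn g m₁ m₂ * t) ^ (-(g : ℝ) / 2) *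
            (Real.cos ((g : ℝ) * θ₀) + dlt m₁ m₂) - dlt m₁ m₂ := by
  set n := nn g m₁ m₂
  set δ := dlt m₁ m₂
  have hg0 : (0 : ℝ) < g := by exact_mod_cast hg
  have hsq : ∀ t ∈ J, r t ^ 2 = 1 - 2 * n * t := by
    intro t ht
    have h := hJconv.eq_of_hasDerivAt_zero (f := fun t => r t ^ 2 + 2 * n * t) (fun x hx => by
      have hpos := (hr x hx).1
      refine (((hr x hx).2.pow 2).add ((hasDerivAt_id x).const_mul (2 * n))).congr_deriv ?_
      field_simp
      ring) hJ0 ht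
    simp only [hr0] at h
    linarith
  have hpos : ∀ t ∈ J, 0 < 1 - 2 * n * t := fun t ht => by
    rw [← hsq t ht]
    exact pow_pos (hr t ht).1 2
  have hconst : ∀ t ∈ J, (cos (g * θ t) + δ) * (1 - 2 * n * t) ^ ((g : ℝ) / 2)
      = cos (g * θ₀) + δ := by
    intro t ht
    have h := hJconv.eq_of_hasDerivAt_zero
      (f := fun t => (cos (g * θ t) + δ) * (1 - 2 * n * t) ^ ((g : ℝ) / 2)) (fun x hx => by
      have hs := hpos x hx
      obtain ⟨⟨hθpos, hθlt⟩, hθ'⟩ := hθ x hx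
      have hsin : sin (g * θ x) ≠ 0 := by
        refine (sin_pos_of_pos_of_lt_pi (mul_pos hg0 hθpos) ?_).ne'
        rwa [lt_div_iff₀ hg0, mul_comm] at hθlt
      rw [hsq x hx] at hθ'
      have hlin : HasDerivAt (fun t => 1 - 2 * n * t) (-(2 * n)) x := by
        simpa using ((hasDerivAt_id x).const_mul (2 * n)).const_sub 1
      refine (((hθ'.const_mul (g : ℝ)).cos.add_const δ).mul
        (hlin.rpow_const (p := (g : ℝ) / 2) (Or.inl hs.ne'))).congr_deriv ?_
      rw [rpow_sub_one hs.ne']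
      field_simp
      ring) hJ0 ht
    simpa [hθ0] using h
  intro t ht
  refine ⟨?_, ?_⟩
  · rw [← hsq t ht, sqrt_sq (hr t ht).1.le]
  · have hs := hpos t ht
    rw [← hconst t ht, neg_div, rpow_neg hs.le]
    have := (rpow_pos_of_pos hs ((g : ℝ) / 2)).ne'
    field_simp
    ring
end

section
/- Let J ⊆ ℝ be an interval containing 0 and let θ : J → (0, π/g) be a differentiable function satisfying θ'(t) = −n·(cot(gθ(t)) + δ·csc(gθ(t))) and θ(0) = θ₀. Then cos(gθ(t)) = e^{gnt}·(cos(gθ₀) + δ) − δ for all t ∈ J. -/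
open Real

/-- The right-hand side of the spherical MCF ODE: `−n(cot gθ + δ csc gθ)`. -/
noncomputable def sphODE (g m₁ m₂ : ℕ) (θ : ℝ) : ℝ :=
  -(nn g m₁ m₂) * (Real.cos ((g : ℝ) * θ) / Real.sin ((g : ℝ) * θ)
    + dlt m₁ m₂ * (1 / Real.sin ((g : ℝ) * θ)))

/-- A solution of `u' = k (u + d)` on a convex set containing `0` is
`u t = exp (k t) (u 0 + d) - d`. -/
theorem eq_exp_mul_sub_of_hasDerivWithinAt {J : Set ℝ} (hJ : Convex ℝ J) (h0 : (0 : ℝ) ∈ J)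
    {u : ℝ → ℝ} {k d : ℝ} (hu : ∀ t ∈ J, HasDerivWithinAt u (k * (u t + d)) J t)
    {t : ℝ} (ht : t ∈ J) : u t = exp (k * t) * (u 0 + d) - d := by
  have hderiv : ∀ s ∈ J,
      HasDerivWithinAt (fun x => exp (-(k * x)) * (u x + d)) 0 J s := by
    intro s hs
    have hexp : HasDerivWithinAt (fun x => exp (-(k * x))) (exp (-(k * s)) * -(k * 1)) J s :=
      (((hasDerivAt_id s).const_mul k).neg.exp).hasDerivWithinAt
    refine (hexp.mul ((hu s hs).add_const d)).congr_deriv ?_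
    ring
  have hconst := hJ.norm_image_sub_le_of_norm_hasDerivWithin_le (C := 0) hderiv
    (fun _ _ => by simp) h0 ht
  have heq : exp (-(k * t)) * (u t + d) = u 0 + d := by
    simpa [sub_eq_zero] using hconst
  rw [← heq, ← mul_assoc, ← exp_add]
  simp

/-- Along the flow, `cos (g θ)` satisfies a linear equation. -/
theorem hasDerivAt_cos_of_sphODE {g m₁ m₂ : ℕ} {θ : ℝ → ℝ} {t : ℝ}
    (hsin : sin ((g : ℝ) * θ t) ≠ 0) (h : HasDerivAt θ (sphODE g m₁ m₂ (θ t)) t) :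
    HasDerivAt (fun s => cos ((g : ℝ) * θ s))
      ((g : ℝ) * nn g m₁ m₂ * (cos ((g : ℝ) * θ t) + dlt m₁ m₂)) t := by
  refine (h.const_mul (g : ℝ)).cos.congr_deriv ?_
  unfold sphODE
  field_simp

/-- Proposition 4.3: the explicit solution of the spherical MCF for isoparametric
hypersurfaces: `cos gθ(t) = e^{gnt}(cos gθ₀ + δ) − δ`. -/
theorem spherical_mcf_solution (g m₁ m₂ : ℕ) (hg : 1 ≤ g)
    (hm₁ : 0 < m₁) (hm₂ : 0 < m₂) (hodd : Odd g → m₁ = m₂)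
    (J : Set ℝ) (hJconv : Convex ℝ J) (hJ0 : (0 : ℝ) ∈ J)
    (θ : ℝ → ℝ) (θ₀ : ℝ)
    (hθ : ∀ t ∈ J, θ t ∈ Set.Ioo 0 (π / (g : ℝ)) ∧
      HasDerivAt θ (sphODE g m₁ m₂ (θ t)) t)
    (hθ0 : θ 0 = θ₀) :
    ∀ t ∈ J,
      Real.cos ((g : ℝ) * θ t)
        = Real.exp ((g : ℝ) * nn g m₁ m₂ * t) *
            (Real.cos ((g : ℝ) * θ₀) + dlt m₁ m₂) - dlt m₁ m₂ := by
  intro t ht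
  have hg0 : (0 : ℝ) < g := by exact_mod_cast hg
  rw [← hθ0]
  refine eq_exp_mul_sub_of_hasDerivWithinAt hJconv hJ0 (u := fun s => cos ((g : ℝ) * θ s))
    (fun s hs => ?_) ht
  obtain ⟨⟨hpos, hlt⟩, hd⟩ := hθ s hs
  have hsin : 0 < sin ((g : ℝ) * θ s) :=
    sin_pos_of_pos_of_lt_pi (mul_pos hg0 hpos) (by rwa [lt_div_iff₀' hg0] at hlt)
  exact (hasDerivAt_cos_of_sphODE hsin.ne' hd).hasDerivWithinAt
end

section
/- Let θ : (−∞, 0] → (0, π/g) be a differentiable function satisfying θ'(t) = −n·(cot(gθ(t)) + δ·csc(gθ(t))). Then lim_{t → −∞} θ(t) = θ_min, and lim_{t → −∞} A2(θ(t)) = (g − 1)·n. -/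
open Real

/-- `A2(θ) = ng(1 + δ cos gθ)/sin²(gθ) − n`, the squared norm of the spherical shape
operator of the isoparametric hypersurface at angle `θ`. -/
noncomputable def A2 (g m₁ m₂ : ℕ) (θ : ℝ) : ℝ :=
  nn g m₁ m₂ * (g : ℝ) * (1 + dlt m₁ m₂ * Real.cos ((g : ℝ) * θ)) /
    (Real.sin ((g : ℝ) * θ)) ^ 2 - nn g m₁ m₂

/-- `H2(θ) = n²(cos gθ + δ)²/sin²(gθ)`, the squared norm of the spherical mean
curvature of the isoparametric hypersurface at angle `θ`. -/
noncomputable def H2 (g m₁ m₂ : ℕ) (θ : ℝ) : ℝ :=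
  (nn g m₁ m₂) ^ 2 * (Real.cos ((g : ℝ) * θ) + dlt m₁ m₂) ^ 2 /
    (Real.sin ((g : ℝ) * θ)) ^ 2

/-- A solution of `u' = k u` on `(-∞, 0]` with `k > 0` tends to `0` at `-∞`. -/
lemma tendsto_zero_atBot_of_hasDerivAt_mul {u : ℝ → ℝ} {k : ℝ} (hk : 0 < k)
    (hu : ∀ t ≤ (0 : ℝ), HasDerivAt u (k * u t) t) :
    Filter.Tendsto u Filter.atBot (nhds 0) := by
  have hw : ∀ t ≤ (0 : ℝ), HasDerivAt (fun s => u s * Real.exp (-(k * s))) 0 t := by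
    intro t ht
    have he : HasDerivAt (fun s => Real.exp (-(k * s))) (Real.exp (-(k * t)) * -(k * 1)) t :=
      ((hasDerivAt_id t).const_mul k).neg.exp
    exact ((hu t ht).mul he).congr_deriv (by ring)
  have hsol : ∀ t ≤ (0 : ℝ), u 0 * Real.exp (k * t) = u t := by
    intro t ht
    have h := constant_of_has_deriv_right_zero
      (fun s hs => (hw s hs.2).continuousAt.continuousWithinAt)
      (fun s hs => (hw s hs.2.le).hasDerivWithinAt) 0 (Set.right_mem_Icc.2 ht)
    simp only [mul_zero, neg_zero, Real.exp_zero, mul_one] at h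
    rw [h, mul_assoc, ← Real.exp_add, neg_add_cancel, Real.exp_zero, mul_one]
  have hexp : Filter.Tendsto (fun t => u 0 * Real.exp (k * t)) Filter.atBot (nhds 0) := by
    simpa using (Real.tendsto_exp_atBot.comp
      (Filter.tendsto_id.const_mul_atBot hk)).const_mul (u 0)
  refine hexp.congr' ?_
  filter_upwards [Filter.eventually_le_atBot 0] with t ht using hsol t ht

/-- Theorem 4.10 (first part): along an ancient spherical MCF of isoparametric
hypersurfaces, `θ(t) → θ_min` and `‖A(t)‖² → (g−1)n` as `t → −∞`. -/
theorem ancient_limit_theta_A (g m₁ m₂ : ℕ) (hg : 1 ≤ g)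
    (hm₁ : 0 < m₁) (hm₂ : 0 < m₂) (hodd : Odd g → m₁ = m₂)
    (θmin : ℝ) (hθmin : θmin ∈ Set.Ioo 0 (π / (g : ℝ)))
    (hmin : Real.cos ((g : ℝ) * θmin) = -dlt m₁ m₂)
    (θ : ℝ → ℝ)
    (hθ : ∀ t ≤ (0 : ℝ), θ t ∈ Set.Ioo 0 (π / (g : ℝ)) ∧
      HasDerivAt θ (sphODE g m₁ m₂ (θ t)) t) :
    Filter.Tendsto θ Filter.atBot (nhds θmin) ∧
    Filter.Tendsto (fun t => A2 g m₁ m₂ (θ t)) Filter.atBot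
      (nhds (((g : ℝ) - 1) * nn g m₁ m₂)) := by
  have hg0 : (0 : ℝ) < g := by exact_mod_cast hg
  have hn : 0 < nn g m₁ m₂ := by
    unfold nn
    positivity
  have hmem : ∀ x ∈ Set.Ioo 0 (π / (g : ℝ)), 0 < (g : ℝ) * x ∧ (g : ℝ) * x < π :=
    fun x hx => ⟨mul_pos hg0 hx.1, (lt_div_iff₀' hg0).1 hx.2⟩
  have harccos : ∀ x ∈ Set.Ioo 0 (π / (g : ℝ)),
      Real.arccos (Real.cos ((g : ℝ) * x)) / g = x := fun x hx => by
    rw [Real.arccos_cos (hmem x hx).1.le (hmem x hx).2.le, mul_div_cancel_left₀ _ hg0.ne']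
  have hu : Filter.Tendsto (fun t => Real.cos ((g : ℝ) * θ t) + dlt m₁ m₂)
      Filter.atBot (nhds 0) := by
    refine tendsto_zero_atBot_of_hasDerivAt_mul (mul_pos hg0 hn) fun t ht => ?_
    obtain ⟨hx, hd⟩ := hθ t ht
    have hs := (Real.sin_pos_of_pos_of_lt_pi (hmem _ hx).1 (hmem _ hx).2).ne'
    refine ((hd.const_mul (g : ℝ)).cos.add_const _).congr_deriv ?_
    unfold sphODE
    field_simp
  have hcos : Filter.Tendsto (fun t => Real.cos ((g : ℝ) * θ t)) Filter.atBot
      (nhds (Real.cos ((g : ℝ) * θmin))) := by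
    simpa [hmin] using hu.sub_const (dlt m₁ m₂)
  have hlim : Filter.Tendsto θ Filter.atBot (nhds θmin) := by
    have h := ((Real.continuous_arccos.tendsto _).comp hcos).div_const (g : ℝ)
    rw [harccos θmin hθmin] at h
    refine h.congr' ?_
    filter_upwards [Filter.eventually_le_atBot 0] with t ht using harccos _ (hθ t ht).1
  refine ⟨hlim, ?_⟩
  have hs := (Real.sin_pos_of_pos_of_lt_pi (hmem _ hθmin).1 (hmem _ hθmin).2).ne'
  have hA : A2 g m₁ m₂ θmin = ((g : ℝ) - 1) * nn g m₁ m₂ := by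
    have hsq : 1 + dlt m₁ m₂ * Real.cos ((g : ℝ) * θmin) = Real.sin ((g : ℝ) * θmin) ^ 2 := by
      rw [Real.sin_sq, hmin]
      ring
    rw [A2, hsq, mul_div_cancel_right₀ _ (pow_ne_zero 2 hs)]
    ring
  have hcont : ContinuousAt (A2 g m₁ m₂) θmin := by
    unfold A2
    refine ContinuousAt.sub (ContinuousAt.div ?_ ?_ (pow_ne_zero 2 hs)) continuousAt_const
    all_goals fun_prop
  rw [← hA]
  exact hcont.tendsto.comp hlim
end

section
/- Let θ : (−∞, 0] → (0, π/g) be a differentiable function satisfying θ'(t) = −n·(cot(gθ(t)) + δ·csc(gθ(t))) with θ(0) = θ₀ ≠ θ_min. Then lim_{t → −∞} H2(θ(t))·e^{−2gnt} = n²·(cos(gθ₀) + δ)² / (1 − δ²). -/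
open Real

theorem sin_mul_pos_of_mem_Ioo {g : ℕ} (hg : 1 ≤ g) {x : ℝ}
    (hx : x ∈ Set.Ioo 0 (π / (g : ℝ))) : 0 < Real.sin ((g : ℝ) * x) := by
  have hg' : (0 : ℝ) < g := by exact_mod_cast hg
  refine Real.sin_pos_of_pos_of_lt_pi (mul_pos hg' hx.1) ?_
  rw [mul_comm]
  exact (lt_div_iff₀ hg').1 hx.2

/-- `cos gθ + δ` is an exact exponential along the flow. -/
theorem cos_add_dlt_eq_mul_exp {g m₁ m₂ : ℕ} (hg : 1 ≤ g) {θ : ℝ → ℝ}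
    (hθ : ∀ t ≤ (0 : ℝ), θ t ∈ Set.Ioo 0 (π / (g : ℝ)) ∧
      HasDerivAt θ (sphODE g m₁ m₂ (θ t)) t) {t : ℝ} (ht : t ≤ 0) :
    Real.cos ((g : ℝ) * θ t) + dlt m₁ m₂ =
      (Real.cos ((g : ℝ) * θ 0) + dlt m₁ m₂) * Real.exp ((g : ℝ) * nn g m₁ m₂ * t) := by
  have hderiv : ∀ s ≤ (0 : ℝ), HasDerivAt (fun s => (Real.cos ((g : ℝ) * θ s) + dlt m₁ m₂) *
      Real.exp (-((g : ℝ) * nn g m₁ m₂ * s))) 0 s := by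
    intro s hs
    have hsin := (sin_mul_pos_of_mem_Ioo hg (hθ s hs).1).ne'
    have hcos := (((hθ s hs).2.const_mul (g : ℝ)).cos).add_const (dlt m₁ m₂)
    have hexp := (((hasDerivAt_id s).const_mul ((g : ℝ) * nn g m₁ m₂)).neg).exp
    refine (hcos.mul hexp).congr_deriv ?_
    simp only [sphODE, id]
    field_simp
    ring
  have hconst := constant_of_has_deriv_right_zero (a := t) (b := 0)
    (fun s hs => (hderiv s hs.2).continuousAt.continuousWithinAt)
    (fun s hs => (hderiv s hs.2.le).hasDerivWithinAt) 0 ⟨ht, le_rfl⟩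
  simp only [mul_zero, neg_zero, Real.exp_zero, mul_one] at hconst
  rw [hconst, mul_assoc, ← Real.exp_add, neg_add_cancel, Real.exp_zero, mul_one]

/-- Theorem 4.10 (second part): along a non-stationary ancient spherical MCF of
isoparametric hypersurfaces, `H²(t)·e^{−2gnt} → n²(cos gθ₀ + δ)²/(1 − δ²)` as
`t → −∞`. -/
theorem ancient_limit_H (g m₁ m₂ : ℕ) (hg : 1 ≤ g)
    (hm₁ : 0 < m₁) (hm₂ : 0 < m₂) (hodd : Odd g → m₁ = m₂)
    (θmin : ℝ) (hθmin : θmin ∈ Set.Ioo 0 (π / (g : ℝ)))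
    (hmin : Real.cos ((g : ℝ) * θmin) = -dlt m₁ m₂)
    (θ : ℝ → ℝ)
    (hθ : ∀ t ≤ (0 : ℝ), θ t ∈ Set.Ioo 0 (π / (g : ℝ)) ∧
      HasDerivAt θ (sphODE g m₁ m₂ (θ t)) t)
    (hne : θ 0 ≠ θmin) :
    Filter.Tendsto
      (fun t => H2 g m₁ m₂ (θ t) * Real.exp (-(2 * (g : ℝ) * nn g m₁ m₂ * t)))
      Filter.atBot
      (nhds ((nn g m₁ m₂) ^ 2 * (Real.cos ((g : ℝ) * θ 0) + dlt m₁ m₂) ^ 2 /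
        (1 - (dlt m₁ m₂) ^ 2))) := by
  have hg' : (0 : ℝ) < g := by exact_mod_cast hg
  have hn : 0 < nn g m₁ m₂ := by unfold nn; positivity
  have hδ : 1 - dlt m₁ m₂ ^ 2 ≠ 0 := by
    have hsin := sin_mul_pos_of_mem_Ioo hg hθmin
    have hsq := Real.sin_sq_add_cos_sq ((g : ℝ) * θmin)
    rw [hmin] at hsq
    nlinarith [pow_pos hsin 2]
  have hexp : Filter.Tendsto (fun t => Real.exp ((g : ℝ) * nn g m₁ m₂ * t))
      Filter.atBot (nhds 0) :=
    Real.tendsto_exp_atBot.comp (Filter.tendsto_id.const_mul_atBot (mul_pos hg' hn))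
  set c := Real.cos ((g : ℝ) * θ 0) + dlt m₁ m₂ with hc
  have hlim : Filter.Tendsto (fun t => nn g m₁ m₂ ^ 2 * c ^ 2 /
      (1 - (c * Real.exp ((g : ℝ) * nn g m₁ m₂ * t) - dlt m₁ m₂) ^ 2)) Filter.atBot
      (nhds (nn g m₁ m₂ ^ 2 * c ^ 2 / (1 - dlt m₁ m₂ ^ 2))) := by
    refine tendsto_const_nhds.div ?_ hδ
    simpa using (((hexp.const_mul c).sub_const (dlt m₁ m₂)).pow 2).const_sub 1
  refine hlim.congr' ?_
  filter_upwards [Filter.eventually_le_atBot (0 : ℝ)] with t ht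
  have hu := cos_add_dlt_eq_mul_exp hg hθ ht
  rw [← hc] at hu
  have hsq : Real.exp ((g : ℝ) * nn g m₁ m₂ * t) ^ 2 *
      Real.exp (-(2 * (g : ℝ) * nn g m₁ m₂ * t)) = 1 := by
    rw [← Real.exp_nat_mul, ← Real.exp_add, Real.exp_eq_one_iff]
    push_cast
    ring
  rw [H2, hu, Real.sin_sq, eq_sub_of_add_eq hu, div_mul_eq_mul_div, mul_pow]
  congr 1
  linear_combination (-(nn g m₁ m₂ ^ 2 * c ^ 2)) * hsq
end

section
/- Suppose δ > 0 and g = 2 or g = 4, and define φ(θ) = A2(θ) − H2(θ)/n for θ ∈ (0, π/g). Then for every ε with 0 < ε < 1 there exists c₀ > 0 such that for every differentiable θ : (−∞, 0] → (0, π/g) satisfying θ'(t) = −n·(cot(gθ(t)) + δ·csc(gθ(t))): (a) if θ(0) ∈ (θ_min − c₀, θ_min) then (g − 1 − ε)·n ≤ φ(θ(t)) ≤ (g − 1)·n for all t ≤ 0; (b) if θ(0) ∈ (θ_min, θ_min + c₀) then (g − 1)·n ≤ φ(θ(t)) ≤ (g − 1 + ε)·n for all t ≤ 0. -/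
open Real

/-- Along the spherical mean curvature flow, `cos gθ + δ` grows exponentially at rate `gn`. -/
theorem cos_add_dlt_eq_of_hasDerivAt_sphODE {g m₁ m₂ : ℕ} {θ : ℝ → ℝ}
    (hθ : ∀ t ≤ (0 : ℝ), Real.sin ((g : ℝ) * θ t) ≠ 0 ∧
      HasDerivAt θ (sphODE g m₁ m₂ (θ t)) t) {t : ℝ} (ht : t ≤ 0) :
    Real.cos ((g : ℝ) * θ t) + dlt m₁ m₂ =
      (Real.cos ((g : ℝ) * θ 0) + dlt m₁ m₂) * Real.exp ((g : ℝ) * nn g m₁ m₂ * t) := by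
  set k : ℝ := (g : ℝ) * nn g m₁ m₂ with hk
  have hderiv : ∀ s ≤ (0 : ℝ), HasDerivAt
      (fun s ↦ (Real.cos ((g : ℝ) * θ s) + dlt m₁ m₂) * Real.exp (-(k * s))) 0 s := by
    intro s hs
    obtain ⟨hsin, hd⟩ := hθ s hs
    have h1 := ((hd.const_mul (g : ℝ)).cos).add_const (dlt m₁ m₂)
    have h2 := (((hasDerivAt_id s).const_mul k).neg).exp
    refine (h1.mul h2).congr_deriv ?_
    simp only [sphODE, id, hk, Pi.neg_apply]
    field_simp
    ring
  have hconst := constant_of_has_deriv_right_zero (a := t) (b := 0)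
    (fun s hs ↦ (hderiv s hs.2).continuousAt.continuousWithinAt)
    (fun s hs ↦ (hderiv s hs.2.le).hasDerivWithinAt) 0 ⟨ht, le_rfl⟩
  simp only [mul_zero, neg_zero, Real.exp_zero, mul_one] at hconst
  rw [hconst, mul_assoc, ← Real.exp_add]
  simp

/-- The deviation of `‖A‖² - ‖H‖²/n` from its value `(g - 1)n` at the minimal hypersurface,
in factored form. -/
theorem A2_sub_H2_div_eq {g m₁ m₂ : ℕ} {θ : ℝ} (hn : nn g m₁ m₂ ≠ 0)
    (hsin : Real.sin ((g : ℝ) * θ) ≠ 0) :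
    A2 g m₁ m₂ θ - H2 g m₁ m₂ θ / nn g m₁ m₂ =
      ((g : ℝ) - 1 + (Real.cos ((g : ℝ) * θ) + dlt m₁ m₂) *
        (((g : ℝ) - 1) * Real.cos ((g : ℝ) * θ) - dlt m₁ m₂) /
          (1 - Real.cos ((g : ℝ) * θ) ^ 2)) * nn g m₁ m₂ := by
  have hsq : 1 - Real.cos ((g : ℝ) * θ) ^ 2 = Real.sin ((g : ℝ) * θ) ^ 2 :=
    (Real.sin_sq _).symm
  have hne : 1 - Real.cos ((g : ℝ) * θ) ^ 2 ≠ 0 := hsq ▸ pow_ne_zero 2 hsin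
  rw [A2, H2, ← hsq]
  field_simp
  ring

/-- Proposition 4.17(2): if `δ > 0` (so `g = 2` or `4`), then for every `0 < ε < 1`
there is `c₀ > 0` such that any ancient spherical MCF of isoparametric hypersurfaces
with `θ(0) ∈ (θ_min − c₀, θ_min)` satisfies `(g−1−ε)n ≤ φ(θ(t)) ≤ (g−1)n`, and with
`θ(0) ∈ (θ_min, θ_min + c₀)` satisfies `(g−1)n ≤ φ(θ(t)) ≤ (g−1+ε)n`, for all
`t ≤ 0`, where `φ(θ) = ‖A‖² − ‖H‖²/n`. -/
theorem traceless_estimate_delta_pos (g m₁ m₂ : ℕ)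
    (hg24 : g = 2 ∨ g = 4)
    (hm₁ : 0 < m₁) (hm₂ : 0 < m₂) (hodd : Odd g → m₁ = m₂)
    (hδ : 0 < dlt m₁ m₂)
    (θmin : ℝ) (hθmin : θmin ∈ Set.Ioo 0 (π / (g : ℝ)))
    (hmin : Real.cos ((g : ℝ) * θmin) = -dlt m₁ m₂) :
    ∀ ε : ℝ, 0 < ε → ε < 1 →
      ∃ c₀ > (0 : ℝ), ∀ θ : ℝ → ℝ,
        (∀ t ≤ (0 : ℝ), θ t ∈ Set.Ioo 0 (π / (g : ℝ)) ∧
          HasDerivAt θ (sphODE g m₁ m₂ (θ t)) t) →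
        (θ 0 ∈ Set.Ioo (θmin - c₀) θmin →
          ∀ t ≤ (0 : ℝ),
            ((g : ℝ) - 1 - ε) * nn g m₁ m₂
              ≤ A2 g m₁ m₂ (θ t) - H2 g m₁ m₂ (θ t) / nn g m₁ m₂ ∧
            A2 g m₁ m₂ (θ t) - H2 g m₁ m₂ (θ t) / nn g m₁ m₂
              ≤ ((g : ℝ) - 1) * nn g m₁ m₂) ∧
        (θ 0 ∈ Set.Ioo θmin (θmin + c₀) →
          ∀ t ≤ (0 : ℝ),
            ((g : ℝ) - 1) * nn g m₁ m₂
              ≤ A2 g m₁ m₂ (θ t) - H2 g m₁ m₂ (θ t) / nn g m₁ m₂ ∧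
            A2 g m₁ m₂ (θ t) - H2 g m₁ m₂ (θ t) / nn g m₁ m₂
              ≤ ((g : ℝ) - 1 + ε) * nn g m₁ m₂) := by
  intro ε hε _
  have hg : (1 : ℝ) ≤ g := by rcases hg24 with rfl | rfl <;> norm_num
  have hg0 : (0 : ℝ) < g := by linarith
  have hn : 0 < nn g m₁ m₂ := by unfold nn; positivity
  have hrange : ∀ x ∈ Set.Ioo 0 (π / (g : ℝ)), 0 < (g : ℝ) * x ∧ (g : ℝ) * x < π :=
    fun x hx ↦ ⟨mul_pos hg0 hx.1, by rw [mul_comm]; exact (lt_div_iff₀ hg0).1 hx.2⟩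
  have hsin : ∀ x ∈ Set.Ioo 0 (π / (g : ℝ)), 0 < Real.sin ((g : ℝ) * x) :=
    fun x hx ↦ Real.sin_pos_of_pos_of_lt_pi (hrange x hx).1 (hrange x hx).2
  set δ := dlt m₁ m₂ with hδdef
  have hδsq : 0 < 1 - (-δ) ^ 2 := by
    rw [← hmin, ← Real.sin_sq]
    exact pow_pos (hsin θmin hθmin) 2
  let F : ℝ → ℝ := fun u ↦ (u + δ) * (((g : ℝ) - 1) * u - δ) / (1 - u ^ 2)
  have hF : ContinuousAt F (-δ) := by
    refine ContinuousAt.div (by fun_prop) (by fun_prop) hδsq.ne'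
  have hF0 : F (-δ) = 0 := by simp [F]
  obtain ⟨η, hη, hFη⟩ := Metric.continuousAt_iff.1 hF ε hε
  have hcos : ContinuousAt (fun x : ℝ ↦ Real.cos ((g : ℝ) * x)) θmin := by fun_prop
  obtain ⟨c₀, hc₀, hcη⟩ := Metric.continuousAt_iff.1 hcos (min η δ) (lt_min hη hδ)
  simp only [Real.dist_eq, hF0, hmin, sub_zero, sub_neg_eq_add] at hFη hcη
  refine ⟨c₀, hc₀, fun θ hθ ↦ ?_⟩
  have hflow : ∀ t ≤ (0 : ℝ), Real.cos ((g : ℝ) * θ t) + δ =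
      (Real.cos ((g : ℝ) * θ 0) + δ) * Real.exp ((g : ℝ) * nn g m₁ m₂ * t) := fun t ht ↦
    cos_add_dlt_eq_of_hasDerivAt_sphODE (fun s hs ↦ ⟨(hsin _ (hθ s hs).1).ne', (hθ s hs).2⟩) ht
  have hexp : ∀ t ≤ (0 : ℝ), Real.exp ((g : ℝ) * nn g m₁ m₂ * t) ≤ 1 := fun t ht ↦
    Real.exp_le_one_iff.2 (mul_nonpos_of_nonneg_of_nonpos (by positivity) ht)
  have hsmall : |θ 0 - θmin| < c₀ → ∀ t ≤ (0 : ℝ),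
      |Real.cos ((g : ℝ) * θ t) + δ| < min η δ := by
    intro h0 t ht
    rw [hflow t ht, abs_mul, Real.abs_exp]
    exact (mul_le_of_le_one_right (abs_nonneg _) (hexp t ht)).trans_lt (hcη h0)
  have hφ : ∀ t ≤ (0 : ℝ), A2 g m₁ m₂ (θ t) - H2 g m₁ m₂ (θ t) / nn g m₁ m₂ =
      ((g : ℝ) - 1 + F (Real.cos ((g : ℝ) * θ t))) * nn g m₁ m₂ := fun t ht ↦
    A2_sub_H2_div_eq hn.ne' (hsin _ (hθ t ht).1).ne'
  have hfactor : |θ 0 - θmin| < c₀ → ∀ t ≤ (0 : ℝ),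
      ((g : ℝ) - 1) * Real.cos ((g : ℝ) * θ t) - δ ≤ 0 := by
    intro h0 t ht
    have hneg : Real.cos ((g : ℝ) * θ t) < 0 := by
      linarith [(abs_lt.1 ((hsmall h0 t ht).trans_le (min_le_right _ _))).2]
    nlinarith
  have hden : ∀ t ≤ (0 : ℝ), 0 ≤ 1 - Real.cos ((g : ℝ) * θ t) ^ 2 := fun t _ ↦ by
    rw [← Real.sin_sq]; positivity
  have hθ0 := hrange _ (hθ 0 le_rfl).1
  have hθm := hrange _ hθmin
  constructor
  · rintro ⟨hlo, hhi⟩ t ht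
    have h0 : |θ 0 - θmin| < c₀ := abs_lt.2 ⟨by linarith, by linarith⟩
    have hu0 : 0 < Real.cos ((g : ℝ) * θ 0) + δ := by
      linarith [Real.cos_lt_cos_of_nonneg_of_le_pi hθ0.1.le hθm.2.le
        (mul_lt_mul_of_pos_left hhi hg0)]
    have hu : 0 ≤ Real.cos ((g : ℝ) * θ t) + δ := by rw [hflow t ht]; positivity
    have hFneg : F (Real.cos ((g : ℝ) * θ t)) ≤ 0 :=
      div_nonpos_of_nonpos_of_nonneg
        (mul_nonpos_of_nonneg_of_nonpos hu (hfactor h0 t ht)) (hden t ht)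
    have hFε := abs_lt.1 (hFη ((hsmall h0 t ht).trans_le (min_le_left _ _)))
    rw [hφ t ht]
    constructor <;> gcongr <;> linarith
  · rintro ⟨hlo, hhi⟩ t ht
    have h0 : |θ 0 - θmin| < c₀ := abs_lt.2 ⟨by linarith, by linarith⟩
    have hu0 : Real.cos ((g : ℝ) * θ 0) + δ < 0 := by
      linarith [Real.cos_lt_cos_of_nonneg_of_le_pi hθm.1.le hθ0.2.le
        (mul_lt_mul_of_pos_left hlo hg0)]
    have hu : Real.cos ((g : ℝ) * θ t) + δ ≤ 0 := by
      rw [hflow t ht]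
      exact mul_nonpos_of_nonpos_of_nonneg hu0.le (Real.exp_pos _).le
    have hFpos : 0 ≤ F (Real.cos ((g : ℝ) * θ t)) :=
      div_nonneg (mul_nonneg_of_nonpos_of_nonpos hu (hfactor h0 t ht)) (hden t ht)
    have hFε := abs_lt.1 (hFη ((hsmall h0 t ht).trans_le (min_le_left _ _)))
    rw [hφ t ht]
    constructor <;> gcongr <;> linarith
end
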